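/- arXiv:1106.1768 — 11 statements merged into one kernel-verified Lean document; each statement's English description precedes it below -/
import Mathlib

section
/- Let 0 < a ≤ 1 ≤ b and define φ(t) = max{t^a, t^b} for t > 0. Then for every c ≥ 1 and every t > 0, one has log(1 + c·φ(t)) ≤ c · max{ (log(1+t))^a , b·log(1+t) }. -/
theorem Real.log_one_add_mul_le {r x : ℝ} (hr : 1 ≤ r) (hx : 0 ≤ x) :
    Real.log (1 + r * x) ≤ r * Real.log (1 + x) := by
  rw [← Real.log_rpow (by linarith)]
  exact Real.log_le_log (by positivity)
    (one_add_mul_self_le_rpow_one_add (by linarith) hr)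

theorem Real.log_one_add_rpow_le_mul_log {b t : ℝ} (hb : 1 ≤ b) (ht : 0 ≤ t) :
    Real.log (1 + t ^ b) ≤ b * Real.log (1 + t) := by
  rw [← Real.log_rpow (by linarith)]
  refine Real.log_le_log (by positivity) ?_
  simpa using Real.add_rpow_le_rpow_add zero_le_one ht hb

theorem Real.log_one_add_rpow_le_rpow_log {a t : ℝ} (ha1 : a ≤ 1) (ht : 0 < t)
    (ht1 : t ≤ 1) : Real.log (1 + t ^ a) ≤ (Real.log (1 + t)) ^ a := by
  have hL : 0 < Real.log (1 + t) := Real.log_pos (by linarith)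
  have hLt : Real.log (1 + t) ≤ t := by
    linarith [Real.log_le_sub_one_of_pos (show 0 < 1 + t by linarith)]
  set L := Real.log (1 + t)
  have hLw : L ≤ L ^ a := Real.self_le_rpow_of_le_one hL.le (hLt.trans ht1) ha1
  have hratio : t ^ a ≤ L ^ a / L * t := by
    have h : (t / L) ^ a ≤ t / L :=
      Real.rpow_le_self_of_one_le ((one_le_div hL).2 hLt) ha1
    rw [Real.div_rpow ht.le hL.le, div_le_iff₀ (by positivity)] at h
    exact h.trans_eq (by ring)
  calc Real.log (1 + t ^ a) ≤ Real.log (1 + L ^ a / L * t) :=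
        Real.log_le_log (by positivity) (by linarith)
    _ ≤ L ^ a / L * L := Real.log_one_add_mul_le ((one_le_div hL).2 hLw) ht.le
    _ = L ^ a := div_mul_cancel₀ _ hL.ne'

/-- **Bernoulli type inequality** (Theorem 1.1 / kmvthm).
For `0 < a ≤ 1 ≤ b`, `φ(t) = max {t^a, t^b}`, `c ≥ 1` and `t > 0`,
`log(1 + c·φ(t)) ≤ c · max { (log(1+t))^a , b·log(1+t) }`. -/
theorem bernoulli_type_ineq (a b c t : ℝ) (ha : 0 < a) (ha1 : a ≤ 1) (hb : 1 ≤ b)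
    (hc : 1 ≤ c) (ht : 0 < t) :
    Real.log (1 + c * max (t ^ a) (t ^ b)) ≤
      c * max ((Real.log (1 + t)) ^ a) (b * Real.log (1 + t)) := by
  refine (Real.log_one_add_mul_le hc (by positivity)).trans ?_
  refine mul_le_mul_of_nonneg_left ?_ (by linarith)
  rcases le_total t 1 with h | h
  · rw [max_eq_left (Real.rpow_le_rpow_of_exponent_ge ht h (ha1.trans hb))]
    exact (Real.log_one_add_rpow_le_rpow_log ha1 ht h).trans (le_max_left _ _)
  · rw [max_eq_right (Real.rpow_le_rpow_of_exponent_le h (ha1.trans hb))]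
    exact (Real.log_one_add_rpow_le_mul_log hb ht.le).trans (le_max_right _ _)
end

section
/- Let 0 < a < 1, p > 0, and define φ(x) = max{x^a, x} for x > 0. Then for all x > 0, (log 2)^{p(1-a)} ≤ (log(1+φ(x)))^p / φ((log(1+x))^p) ≤ 1, and these bounds are best possible. -/
open Real in
/-- The ratio `log (1 + x) / x` is decreasing. -/
theorem log_one_add_le_div_mul_log_one_add {x y : ℝ} (hx : 0 < x) (hxy : x ≤ y) :
    log (1 + y) ≤ y / x * log (1 + x) := by
  have h := one_add_mul_self_le_rpow_one_add (s := x) (by linarith) ((one_le_div hx).2 hxy)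
  rw [div_mul_cancel₀ _ hx.ne'] at h
  calc log (1 + y) ≤ log ((1 + x) ^ (y / x)) := log_le_log (by linarith) h
    _ = y / x * log (1 + x) := log_rpow (by linarith) _

open Real in
theorem log_one_add_rpow_le_rpow_log_one_add {a x : ℝ} (ha : 0 < a) (ha1 : a < 1)
    (hx : 0 < x) (hx1 : x ≤ 1) : log (1 + x ^ a) ≤ log (1 + x) ^ a := by
  have ht : 0 < log (1 + x) := log_pos (by linarith)
  have htx : log (1 + x) ≤ x := by linarith [log_le_sub_one_of_pos (show 0 < 1 + x by linarith)]
  have hxa : x ≤ x ^ a := by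
    simpa using rpow_le_rpow_of_exponent_ge hx hx1 ha1.le
  have hq : log (1 + x) / x ≤ (log (1 + x) / x) ^ a := by
    simpa using rpow_le_rpow_of_exponent_ge (div_pos ht hx) ((div_le_one hx).2 htx) ha1.le
  calc log (1 + x ^ a) ≤ x ^ a / x * log (1 + x) := log_one_add_le_div_mul_log_one_add hx hxa
    _ = x ^ a * (log (1 + x) / x) := by ring
    _ ≤ x ^ a * (log (1 + x) / x) ^ a := by gcongr
    _ = log (1 + x) ^ a := by
      rw [← mul_rpow hx.le (div_pos ht hx).le, mul_div_cancel₀ _ hx.ne']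

open Real in
theorem hasSum_exp_sub_one (y : ℝ) :
    HasSum (fun n : ℕ => y ^ (n + 1) / ((n + 1).factorial : ℝ)) (exp y - 1) := by
  have h := NormedSpace.expSeries_div_hasSum_exp y
  rw [← exp_eq_exp_ℝ] at h
  simpa using (hasSum_nat_add_iff' 1).2 h

open Real in
/-- The function `s ↦ exp (l * s) - 1` is geometrically convex between `s` and `1`. -/
theorem exp_mul_rpow_sub_one_le {a l s : ℝ} (ha : 0 < a) (ha1 : a < 1) (hl : 0 < l)
    (hs : 0 < s) :
    exp (l * s ^ a) - 1 ≤ (exp (l * s) - 1) ^ a * (exp l - 1) ^ (1 - a) := by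
  set A := exp (l * s) - 1 with hA
  set B := exp l - 1 with hB
  have hA0 : 0 < A := sub_pos.2 (one_lt_exp_iff.2 (mul_pos hl hs))
  have hB0 : 0 < B := sub_pos.2 (one_lt_exp_iff.2 hl)
  have hsum := ((((hasSum_exp_sub_one (l * s)).mul_left (a / A)).add
    ((hasSum_exp_sub_one l).mul_left ((1 - a) / B)))).mul_left (A ^ a * B ^ (1 - a))
  rw [← hA, ← hB, div_mul_cancel₀ _ hA0.ne', div_mul_cancel₀ _ hB0.ne', add_sub_cancel,
    mul_one] at hsum
  refine hasSum_le (fun n => ?_) (hasSum_exp_sub_one (l * s ^ a)) hsum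
  set u := (l * s) ^ (n + 1) / ((n + 1).factorial : ℝ) with hu
  set v := l ^ (n + 1) / ((n + 1).factorial : ℝ) with hv
  have hu0 : 0 < u := by positivity
  have hv0 : 0 < v := by positivity
  have huv : (l * s ^ a) ^ (n + 1) / ((n + 1).factorial : ℝ) = u ^ a * v ^ (1 - a) := by
    have h1 : u = v * s ^ (n + 1) := by rw [hu, hv, mul_pow]; ring
    have h2 : (s ^ a) ^ (n + 1) = (s ^ (n + 1)) ^ a := by
      rw [← rpow_natCast, ← rpow_natCast, ← rpow_mul hs.le, ← rpow_mul hs.le, mul_comm]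
    have h3 : v ^ a * v ^ (1 - a) = v := by rw [← rpow_add hv0]; simp
    rw [h1, mul_rpow hv0.le (by positivity), mul_right_comm, h3, mul_pow, h2, hv]
    ring
  have hamgm := geom_mean_le_arith_mean2_weighted ha.le (sub_pos.2 ha1).le
    (div_pos hu0 hA0).le (div_pos hv0 hB0).le (by ring)
  rw [huv]
  calc u ^ a * v ^ (1 - a) = A ^ a * B ^ (1 - a) * ((u / A) ^ a * (v / B) ^ (1 - a)) := by
        rw [div_rpow hu0.le hA0.le, div_rpow hv0.le hB0.le]
        have := rpow_pos_of_pos hA0 a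
        have := rpow_pos_of_pos hB0 (1 - a)
        field_simp
    _ ≤ A ^ a * B ^ (1 - a) * (a * (u / A) + (1 - a) * (v / B)) := by gcongr
    _ = A ^ a * B ^ (1 - a) * (a / A * u + (1 - a) / B * v) := by ring

open Real in
theorem rpow_log_two_mul_rpow_log_one_add_le {a x : ℝ} (ha : 0 < a) (ha1 : a < 1)
    (hx : 0 < x) : log 2 ^ (1 - a) * log (1 + x) ^ a ≤ log (1 + x ^ a) := by
  have hl : 0 < log 2 := log_pos one_lt_two
  have ht : 0 < log (1 + x) := log_pos (by linarith)
  have h := exp_mul_rpow_sub_one_le ha ha1 hl (div_pos ht hl)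
  rw [mul_div_cancel₀ _ hl.ne', exp_log (by linarith), exp_log two_pos,
    show (2 : ℝ) - 1 = 1 by norm_num, one_rpow, mul_one, add_sub_cancel_left] at h
  rw [le_log_iff_exp_le (by positivity)]
  have heq : log 2 ^ (1 - a) * log (1 + x) ^ a = log 2 * (log (1 + x) / log 2) ^ a := by
    rw [div_rpow ht.le hl.le, rpow_sub hl, rpow_one]
    ring
  rw [heq]
  linarith

open Real in
theorem log_one_add_max_rpow_bounds {a x : ℝ} (ha : 0 < a) (ha1 : a < 1) (hx : 0 < x) :
    log 2 ^ (1 - a) * max (log (1 + x) ^ a) (log (1 + x)) ≤ log (1 + max (x ^ a) x) ∧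
      log (1 + max (x ^ a) x) ≤ max (log (1 + x) ^ a) (log (1 + x)) := by
  have hl : 0 < log 2 := log_pos one_lt_two
  have hl1 : log 2 ≤ 1 := by linarith [log_two_lt_d9]
  have ht : 0 < log (1 + x) := log_pos (by linarith)
  rcases le_total x 1 with hx1 | hx1
  · have htl : log (1 + x) ≤ 1 := (log_le_log (by linarith) (by linarith)).trans hl1
    have hxa : x ≤ x ^ a := by simpa using rpow_le_rpow_of_exponent_ge hx hx1 ha1.le
    have hta : log (1 + x) ≤ log (1 + x) ^ a := by
      simpa using rpow_le_rpow_of_exponent_ge ht htl ha1.le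
    rw [max_eq_left hxa, max_eq_left hta]
    exact ⟨rpow_log_two_mul_rpow_log_one_add_le ha ha1 hx,
      log_one_add_rpow_le_rpow_log_one_add ha ha1 hx hx1⟩
  · have hxa : x ^ a ≤ x := by simpa using rpow_le_rpow_of_exponent_le hx1 ha1.le
    have hlt : log 2 ≤ log (1 + x) := log_le_log two_pos (by linarith)
    rw [max_eq_right hxa]
    refine ⟨?_, le_max_right _ _⟩
    rw [mul_max_of_nonneg _ _ (rpow_nonneg hl.le _)]
    refine max_le ?_ (mul_le_of_le_one_left ht.le (rpow_le_one hl.le hl1 (by linarith)))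
    calc log 2 ^ (1 - a) * log (1 + x) ^ a
        ≤ log (1 + x) ^ (1 - a) * log (1 + x) ^ a := by gcongr
      _ = log (1 + x) := by rw [← rpow_add ht]; simp

open Real in
theorem max_rpow_rpow_comm {t : ℝ} (a : ℝ) {p : ℝ} (ht : 0 ≤ t) (hp : 0 ≤ p) :
    max ((t ^ p) ^ a) (t ^ p) = max (t ^ a) t ^ p := by
  rw [← rpow_mul ht, mul_comm, rpow_mul ht]
  exact ((monotoneOn_rpow_Ici_of_exponent_nonneg hp).map_max (rpow_nonneg ht a) ht).symm


/-- Theorem 1.3 (first part): for `0 < a < 1`, `p > 0`, `φ(x) = max {x^a, x}`,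
the ratio `(log(1+φ(x)))^p / φ((log(1+x))^p)` lies between `(log 2)^{p(1-a)}` and `1`
for all `x > 0`, and these bounds are best possible (both are attained, i.e. they are
the least and greatest values of the ratio). -/
theorem bernoulli_log_power_bounds (a p : ℝ) (ha : 0 < a) (ha1 : a < 1) (hp : 0 < p) :
    IsLeast {y : ℝ | ∃ x : ℝ, 0 < x ∧
        y = (Real.log (1 + max (x ^ a) x)) ^ p /
          max (((Real.log (1 + x)) ^ p) ^ a) ((Real.log (1 + x)) ^ p)}
      ((Real.log 2) ^ (p * (1 - a))) ∧
    IsGreatest {y : ℝ | ∃ x : ℝ, 0 < x ∧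
        y = (Real.log (1 + max (x ^ a) x)) ^ p /
          max (((Real.log (1 + x)) ^ p) ^ a) ((Real.log (1 + x)) ^ p)}
      1 := by
  have hl : 0 < Real.log 2 := Real.log_pos one_lt_two
  have hl1 : Real.log 2 ≤ 1 := by linarith [Real.log_two_lt_d9]
  refine ⟨⟨⟨1, one_pos, ?_⟩, ?_⟩, ⟨⟨Real.exp 1 - 1, ?_, ?_⟩, ?_⟩⟩
  · have hla : Real.log 2 ≤ Real.log 2 ^ a := by
      simpa using Real.rpow_le_rpow_of_exponent_ge hl hl1 ha1.le
    rw [Real.one_rpow, max_self, one_add_one_eq_two, max_rpow_rpow_comm a hl.le hp.le,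
      max_eq_left hla, ← Real.rpow_mul hl.le, ← Real.rpow_sub hl]
    ring_nf
  · rintro y ⟨x, hx, rfl⟩
    have ht : 0 < Real.log (1 + x) := Real.log_pos (by linarith)
    have hM : 0 < max (Real.log (1 + x) ^ a) (Real.log (1 + x)) := lt_max_of_lt_right ht
    rw [max_rpow_rpow_comm a ht.le hp.le, le_div_iff₀ (Real.rpow_pos_of_pos hM p), mul_comm p,
      Real.rpow_mul hl.le, ← Real.mul_rpow (Real.rpow_nonneg hl.le _) hM.le]
    exact Real.rpow_le_rpow (by positivity) (log_one_add_max_rpow_bounds ha ha1 hx).1 hp.le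
  · linarith [Real.add_one_lt_exp one_ne_zero]
  · have hx1 : 1 ≤ Real.exp 1 - 1 := by linarith [Real.add_one_le_exp 1]
    have hxa : (Real.exp 1 - 1) ^ a ≤ Real.exp 1 - 1 := by
      simpa using Real.rpow_le_rpow_of_exponent_le hx1 ha1.le
    rw [max_eq_right hxa, add_sub_cancel, Real.log_exp]
    simp
  · rintro y ⟨x, hx, rfl⟩
    have ht : 0 < Real.log (1 + x) := Real.log_pos (by linarith)
    have hM : 0 < max (Real.log (1 + x) ^ a) (Real.log (1 + x)) := lt_max_of_lt_right ht
    have hL : 0 ≤ Real.log (1 + max (x ^ a) x) :=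
      Real.log_nonneg (by linarith [le_max_right (x ^ a) x])
    rw [max_rpow_rpow_comm a ht.le hp.le, div_le_one (Real.rpow_pos_of_pos hM p)]
    exact Real.rpow_le_rpow hL (log_one_add_max_rpow_bounds ha ha1 hx).2 hp.le
end

section
/- Let 0 < a < 1 and define φ(x) = max{x^a, x} for x > 0. Then for all x > 0, (log 2 · log(1 + log 2))^{1-a} ≤ [ log(1+φ(x)) · log(1 + log(1+φ(x))) ] / φ( log(1+x) · log(1 + log(1+x)) ) ≤ 1, and these bounds are best possible. -/
open Real in
lemma log_one_add_div_antitone {x z : ℝ} (hx : 0 < x) (hxz : x ≤ z) :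
    log (1 + z) / z ≤ log (1 + x) / x := by
  have hz : 0 < z := hx.trans_le hxz
  have h := rpow_one_add_le_one_add_mul_self (s := z) (by linarith) (p := x / z)
    (by positivity) ((div_le_one hz).2 hxz)
  rw [div_mul_cancel₀ x hz.ne'] at h
  have h2 := log_le_log (by positivity) h
  rw [log_rpow (by positivity)] at h2
  rw [div_le_div_iff₀ hz hx]
  calc log (1 + z) * x = x / z * log (1 + z) * z := by field_simp
    _ ≤ log (1 + x) * z := by gcongr

open Real in
lemma log_one_add_pos {x : ℝ} (hx : 0 < x) : 0 < log (1 + x) := log_pos (by linarith)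

open Real in
lemma log_one_add_le_self {x : ℝ} (hx : 0 < x) : log (1 + x) ≤ x := by
  linarith [log_le_sub_one_of_pos (show 0 < 1 + x by linarith)]

open Real in
lemma log_one_add_rpow_le {a x : ℝ} (ha1 : a < 1) (hx : 0 < x) (hx1 : x ≤ 1) :
    log (1 + x ^ a) ≤ log (1 + x) ^ a := by
  have hL := log_one_add_pos hx
  have hxa : x ≤ x ^ a := by simpa using rpow_le_rpow_of_exponent_ge hx hx1 ha1.le
  have h1 := log_one_add_div_antitone hx hxa
  have h2 : log (1 + x) / x ≤ (log (1 + x) / x) ^ a := by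
    simpa using rpow_le_rpow_of_exponent_ge (by positivity)
      ((div_le_one hx).2 (log_one_add_le_self hx)) ha1.le
  rw [div_rpow hL.le hx.le] at h2
  exact (div_le_div_iff_of_pos_right (by positivity)).1 (h1.trans h2)

open Real in
lemma concaveOn_log_log_one_add_exp :
    ConcaveOn ℝ Set.univ fun t : ℝ => log (log (1 + exp t)) := by
  have hL : ∀ t : ℝ, 0 < log (1 + exp t) := fun t => log_one_add_pos (exp_pos t)
  have hd : ∀ t : ℝ, HasDerivAt (fun t : ℝ => log (log (1 + exp t)))
      (exp t / (1 + exp t) / log (1 + exp t)) t := fun t =>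
    (((hasDerivAt_exp t).const_add 1).log (by positivity)).log (hL t).ne'
  refine Antitone.concaveOn_univ_of_deriv (fun t => (hd t).differentiableAt) ?_
  intro s t hst
  rw [(hd s).deriv, (hd t).deriv]
  have hle : log (1 + exp s) ≤ log (1 + exp t) :=
    log_le_log (by positivity) (by gcongr)
  have h := convexOn_exp.secant_mono (a := 0) (x := -log (1 + exp t)) (y := -log (1 + exp s))
    trivial trivial trivial (neg_ne_zero.2 (hL t).ne') (neg_ne_zero.2 (hL s).ne')
    (neg_le_neg hle)
  have key : ∀ u : ℝ, (exp (-log (1 + exp u)) - exp 0) / (-log (1 + exp u) - 0) =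
      exp u / (1 + exp u) / log (1 + exp u) := by
    intro u
    have := (hL u).ne'
    have hu : 1 + exp u ≠ 0 := by positivity
    rw [exp_neg, exp_log (by positivity), exp_zero, sub_zero]
    field_simp
    ring
  rwa [key, key] at h

open Real in
lemma log_one_add_geom_mean_ge {a x y : ℝ} (ha : 0 < a) (ha1 : a < 1) (hx : 0 < x) (hy : 0 < y) :
    log (1 + x) ^ a * log (1 + y) ^ (1 - a) ≤ log (1 + x ^ a * y ^ (1 - a)) := by
  have hLx := log_one_add_pos hx
  have hLy := log_one_add_pos hy
  have hm : 0 < x ^ a * y ^ (1 - a) := by positivity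
  have h := concaveOn_log_log_one_add_exp.2 (Set.mem_univ (log x)) (Set.mem_univ (log y))
    ha.le (sub_nonneg.2 ha1.le) (by ring)
  have he : exp (a * log x + (1 - a) * log y) = x ^ a * y ^ (1 - a) := by
    rw [exp_add, rpow_def_of_pos hx, rpow_def_of_pos hy, mul_comm a, mul_comm (1 - a)]
  simp only [smul_eq_mul, exp_log hx, exp_log hy, he] at h
  rw [← log_rpow hLx, ← log_rpow hLy, ← log_mul (by positivity) (by positivity)] at h
  exact (log_le_log_iff (by positivity) (log_one_add_pos hm)).1 h

/-- The function `x ↦ log (1 + x) * log (1 + log (1 + x))`. -/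
noncomputable def logLogProd (x : ℝ) : ℝ :=
  Real.log (1 + x) * Real.log (1 + Real.log (1 + x))

open Real in
lemma logLogProd_pos {x : ℝ} (hx : 0 < x) : 0 < logLogProd x :=
  mul_pos (log_one_add_pos hx) (log_one_add_pos (log_one_add_pos hx))

open Real in
lemma logLogProd_mono {x y : ℝ} (hx : 0 < x) (hxy : x ≤ y) : logLogProd x ≤ logLogProd y := by
  have hLx := log_one_add_pos hx
  have hLLx := log_one_add_pos hLx
  have h : log (1 + x) ≤ log (1 + y) := log_le_log (by positivity) (by gcongr)
  have h2 : log (1 + log (1 + x)) ≤ log (1 + log (1 + y)) :=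
    log_le_log (by positivity) (by gcongr)
  exact mul_le_mul h h2 hLLx.le (hLx.le.trans h)

open Real in
lemma logLogProd_one_le_one : logLogProd 1 ≤ 1 := by
  have h := log_one_add_pos one_pos
  have h1 := log_one_add_le_self one_pos
  exact mul_le_one₀ h1 (log_one_add_pos h).le ((log_one_add_le_self h).trans h1)

open Real in
lemma logLogProd_rpow_le {a x : ℝ} (ha1 : a < 1) (hx : 0 < x) (hx1 : x ≤ 1) :
    logLogProd (x ^ a) ≤ logLogProd x ^ a := by
  have hL := log_one_add_pos hx
  have hLa := log_one_add_pos (rpow_pos_of_pos hx a)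
  have h := log_one_add_rpow_le ha1 hx hx1
  have h2 := log_one_add_rpow_le ha1 hL ((log_one_add_le_self hx).trans hx1)
  rw [logLogProd, logLogProd, mul_rpow hL.le (log_one_add_pos hL).le]
  refine mul_le_mul h (le_trans ?_ h2) (log_one_add_pos hLa).le (by positivity)
  exact log_le_log (by positivity) (by gcongr)

open Real in
lemma le_logLogProd_rpow {a x : ℝ} (ha : 0 < a) (ha1 : a < 1) (hx : 0 < x) :
    logLogProd 1 ^ (1 - a) * logLogProd x ^ a ≤ logLogProd (x ^ a) := by
  have hL := log_one_add_pos hx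
  have hLL := log_one_add_pos hL
  have hL1 := log_one_add_pos one_pos
  have hLL1 := log_one_add_pos hL1
  have h := log_one_add_geom_mean_ge ha ha1 hx one_pos
  rw [one_rpow, mul_one] at h
  have h2 := log_one_add_geom_mean_ge ha ha1 hL hL1
  have h3 : log (1 + log (1 + x) ^ a * log (1 + 1) ^ (1 - a)) ≤ log (1 + log (1 + x ^ a)) :=
    log_le_log (by positivity) (by gcongr)
  calc logLogProd 1 ^ (1 - a) * logLogProd x ^ a
      = (log (1 + x) ^ a * log (1 + 1) ^ (1 - a)) *
        (log (1 + log (1 + x)) ^ a * log (1 + log (1 + 1)) ^ (1 - a)) := by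
        rw [logLogProd, logLogProd, mul_rpow hL1.le hLL1.le, mul_rpow hL.le hLL.le]
        ring
    _ ≤ logLogProd (x ^ a) :=
        mul_le_mul h (h2.trans h3) (by positivity)
          (log_one_add_pos (rpow_pos_of_pos hx a)).le

open Real in
lemma div_max_rpow_self {a s : ℝ} (ha1 : a < 1) (hs : 0 < s) (hs1 : s ≤ 1) :
    s / max (s ^ a) s = s ^ (1 - a) := by
  have h : s ≤ s ^ a := by simpa using rpow_le_rpow_of_exponent_ge hs hs1 ha1.le
  rw [max_eq_left h, rpow_sub hs, rpow_one]

open Real in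
lemma div_max_rpow_self_of_one_le {a s : ℝ} (ha1 : a < 1) (hs1 : 1 ≤ s) :
    s / max (s ^ a) s = 1 := by
  have h : s ^ a ≤ s := by simpa using rpow_le_rpow_of_exponent_le hs1 ha1.le
  rw [max_eq_right h, div_self (by positivity)]

open Real in
lemma max_rpow_self_of_one_le {a x : ℝ} (ha1 : a < 1) (hx1 : 1 ≤ x) : max (x ^ a) x = x :=
  max_eq_right (by simpa using rpow_le_rpow_of_exponent_le hx1 ha1.le)

open Real in
lemma logLogProd_ratio_mem_Icc {a x : ℝ} (ha : 0 < a) (ha1 : a < 1) (hx : 0 < x) :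
    logLogProd (max (x ^ a) x) / max (logLogProd x ^ a) (logLogProd x) ∈
      Set.Icc (logLogProd 1 ^ (1 - a)) 1 := by
  have hs := logLogProd_pos hx
  have h1a : 0 ≤ 1 - a := sub_nonneg.2 ha1.le
  have hc := logLogProd_pos one_pos
  have hc1 := logLogProd_one_le_one
  rcases le_total 1 x with h | h
  · rw [max_rpow_self_of_one_le ha1 h]
    rcases le_total 1 (logLogProd x) with h' | h'
    · rw [div_max_rpow_self_of_one_le ha1 h']
      exact ⟨rpow_le_one hc.le hc1 h1a, le_rfl⟩
    · rw [div_max_rpow_self ha1 hs h']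
      exact ⟨rpow_le_rpow hc.le (logLogProd_mono one_pos h) h1a, rpow_le_one hs.le h' h1a⟩
  · have hxa : x ≤ x ^ a := by simpa using rpow_le_rpow_of_exponent_ge hx h ha1.le
    have hsa : logLogProd x ≤ logLogProd x ^ a := by
      simpa using rpow_le_rpow_of_exponent_ge hs ((logLogProd_mono hx h).trans hc1) ha1.le
    rw [max_eq_left hxa, max_eq_left hsa, Set.mem_Icc, le_div_iff₀ (by positivity),
      div_le_one (by positivity)]
    exact ⟨le_logLogProd_rpow ha ha1 hx, logLogProd_rpow_le ha1 hx h⟩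

open Real in
lemma exists_one_le_logLogProd : ∃ x : ℝ, 1 ≤ x ∧ 1 ≤ logLogProd x := by
  have he : 2 ≤ exp 1 := by linarith [add_one_le_exp (1 : ℝ)]
  refine ⟨exp (exp 1) - 1, by linarith [add_one_le_exp (exp 1)], ?_⟩
  rw [logLogProd, add_sub_cancel, log_exp]
  have : 1 ≤ log (1 + exp 1) := by
    rw [le_log_iff_exp_le (by positivity)]
    linarith
  exact one_le_mul_of_one_le_of_one_le (by linarith) this

/-- Theorem 1.3 (second part): for `0 < a < 1`, `φ(x) = max {x^a, x}` and
`s(x) = log(1+x)·log(1+log(1+x))`, the ratio `s(φ(x)) / φ(s(x))`, i.e.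
`[log(1+φ(x))·log(1+log(1+φ(x)))] / φ(log(1+x)·log(1+log(1+x)))`, lies between
`(log 2 · log(1+log 2))^{1-a}` and `1` for all `x > 0`, and these bounds are best
possible (they are the least and greatest values of the ratio). -/
theorem bernoulli_loglog_bounds (a : ℝ) (ha : 0 < a) (ha1 : a < 1) :
    IsLeast {y : ℝ | ∃ x : ℝ, 0 < x ∧
        y = (Real.log (1 + max (x ^ a) x) *
              Real.log (1 + Real.log (1 + max (x ^ a) x))) /
          max ((Real.log (1 + x) * Real.log (1 + Real.log (1 + x))) ^ a)
              (Real.log (1 + x) * Real.log (1 + Real.log (1 + x)))}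
      ((Real.log 2 * Real.log (1 + Real.log 2)) ^ (1 - a)) ∧
    IsGreatest {y : ℝ | ∃ x : ℝ, 0 < x ∧
        y = (Real.log (1 + max (x ^ a) x) *
              Real.log (1 + Real.log (1 + max (x ^ a) x))) /
          max ((Real.log (1 + x) * Real.log (1 + Real.log (1 + x))) ^ a)
              (Real.log (1 + x) * Real.log (1 + Real.log (1 + x)))}
      1 := by
  have hc : Real.log 2 * Real.log (1 + Real.log 2) = logLogProd 1 := by
    rw [logLogProd, one_add_one_eq_two]
  rw [hc]
  refine ⟨⟨⟨1, one_pos, ?_⟩, ?_⟩, ?_, ?_⟩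
  · have h := div_max_rpow_self ha1 (logLogProd_pos one_pos) logLogProd_one_le_one
    rw [max_rpow_self_of_one_le ha1 le_rfl]
    exact h.symm
  · rintro _ ⟨x, hx, rfl⟩
    exact (logLogProd_ratio_mem_Icc ha ha1 hx).1
  · obtain ⟨x, hx, hs⟩ := exists_one_le_logLogProd
    refine ⟨x, by linarith, ?_⟩
    rw [max_rpow_self_of_one_le ha1 hx]
    exact (div_max_rpow_self_of_one_le ha1 hs).symm
  · rintro _ ⟨x, hx, rfl⟩
    exact (logLogProd_ratio_mem_Icc ha ha1 hx).2
end

section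
/- Let f : (0,∞) → (0,∞) be differentiable, let c ∈ ℝ, c ≠ 0, and set g(x) = f(x^c) / (f(x))^c. Suppose the function h(x) = log f(e^x) is convex on ℝ. Then: g is monotone increasing on (0,1) if c ∈ (0,1); g is monotone increasing on (1,∞) if c > 1; g is monotone increasing on (1,∞) if c < 0; g is monotone decreasing on (1,∞) if c ∈ (0,1); g is monotone decreasing on (0,1) if c > 1; and g is monotone decreasing on (0,1) if c < 0. -/
lemma hasDerivAt_comp_mul_sub_mul {h : ℝ → ℝ} (hd : Differentiable ℝ h) (c t : ℝ) :
    HasDerivAt (fun t => h (c * t) - c * h t) (c * (deriv h (c * t) - deriv h t)) t := by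
  have h1 : HasDerivAt (fun t => c * t) c t := by simpa using (hasDerivAt_id t).const_mul c
  have h2 : HasDerivAt (fun t => h (c * t)) (deriv h (c * t) * c) t :=
    (hd (c * t)).hasDerivAt.comp t h1
  exact (h2.sub ((hd t).hasDerivAt.const_mul c)).congr_deriv (by ring)

lemma mul_sub_nonneg_of_monotone {k : ℝ → ℝ} (hk : Monotone k) {c s t : ℝ}
    (h : 0 ≤ c * (s - t)) : 0 ≤ c * (k s - k t) := by
  rcases lt_trichotomy c 0 with hc | rfl | hc
  · have hst : s ≤ t := by nlinarith
    nlinarith [hk hst]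
  · simp
  · have hst : t ≤ s := by nlinarith
    nlinarith [hk hst]

lemma ConvexOn.monotoneOn_comp_mul_sub_mul {h : ℝ → ℝ} (hd : Differentiable ℝ h)
    (hconv : ConvexOn ℝ Set.univ h) {c : ℝ} {D : Set ℝ} (hD : Convex ℝ D)
    (hc : ∀ t ∈ D, 0 ≤ c * (c * t - t)) :
    MonotoneOn (fun t => h (c * t) - c * h t) D := by
  have hφ := hasDerivAt_comp_mul_sub_mul hd c
  have hk : Monotone (deriv h) :=
    monotoneOn_univ.1 (hconv.monotoneOn_deriv fun x _ => hd x)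
  refine monotoneOn_of_deriv_nonneg hD
    (fun t _ => (hφ t).continuousAt.continuousWithinAt)
    (fun t _ => (hφ t).differentiableAt.differentiableWithinAt) fun t ht => ?_
  rw [(hφ t).deriv]
  exact mul_sub_nonneg_of_monotone hk (hc t (interior_subset ht))

lemma ConvexOn.antitoneOn_comp_mul_sub_mul {h : ℝ → ℝ} (hd : Differentiable ℝ h)
    (hconv : ConvexOn ℝ Set.univ h) {c : ℝ} {D : Set ℝ} (hD : Convex ℝ D)
    (hc : ∀ t ∈ D, c * (c * t - t) ≤ 0) :
    AntitoneOn (fun t => h (c * t) - c * h t) D := by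
  have hφ := hasDerivAt_comp_mul_sub_mul hd c
  have hk : Monotone (deriv h) :=
    monotoneOn_univ.1 (hconv.monotoneOn_deriv fun x _ => hd x)
  refine antitoneOn_of_deriv_nonpos hD
    (fun t _ => (hφ t).continuousAt.continuousWithinAt)
    (fun t _ => (hφ t).differentiableAt.differentiableWithinAt) fun t ht => ?_
  rw [(hφ t).deriv]
  have := mul_sub_nonneg_of_monotone hk (c := c) (s := t) (t := c * t)
    (by linarith [hc t (interior_subset ht)])
  linarith

lemma div_rpow_eq_exp_log_comp_exp {f : ℝ → ℝ} (hf_pos : ∀ x, 0 < x → 0 < f x) (c : ℝ)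
    {x : ℝ} (hx : 0 < x) :
    f (x ^ c) / f x ^ c = Real.exp (Real.log (f (Real.exp (c * Real.log x))) -
      c * Real.log (f (Real.exp (Real.log x)))) := by
  rw [Real.exp_sub, Real.exp_log (hf_pos _ (Real.exp_pos _)), Real.exp_log hx,
    Real.rpow_def_of_pos hx, Real.rpow_def_of_pos (hf_pos x hx), mul_comm c, mul_comm c]

/-- Theorem 1.4 (1): if `f : (0,∞) → (0,∞)` is differentiable and
`h(x) = log f(e^x)` is convex on ℝ, then `g(x) = f(x^c)/(f x)^c` is
monotone increasing on `(0,1)` for `c ∈ (0,1)`, increasing on `(1,∞)` for `c > 1`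
or `c < 0`, decreasing on `(1,∞)` for `c ∈ (0,1)`, and decreasing on `(0,1)`
for `c > 1` or `c < 0`. -/
theorem monotonicity_of_ratio_convex (f : ℝ → ℝ) (c : ℝ) (hc : c ≠ 0)
    (hf_pos : ∀ x, 0 < x → 0 < f x)
    (hf_diff : DifferentiableOn ℝ f (Set.Ioi 0))
    (hconv : ConvexOn ℝ Set.univ (fun x : ℝ => Real.log (f (Real.exp x)))) :
    ((0 < c ∧ c < 1) → MonotoneOn (fun x : ℝ => f (x ^ c) / (f x) ^ c) (Set.Ioo 0 1)) ∧
    (1 < c → MonotoneOn (fun x : ℝ => f (x ^ c) / (f x) ^ c) (Set.Ioi 1)) ∧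
    (c < 0 → MonotoneOn (fun x : ℝ => f (x ^ c) / (f x) ^ c) (Set.Ioi 1)) ∧
    ((0 < c ∧ c < 1) → AntitoneOn (fun x : ℝ => f (x ^ c) / (f x) ^ c) (Set.Ioi 1)) ∧
    (1 < c → AntitoneOn (fun x : ℝ => f (x ^ c) / (f x) ^ c) (Set.Ioo 0 1)) ∧
    (c < 0 → AntitoneOn (fun x : ℝ => f (x ^ c) / (f x) ^ c) (Set.Ioo 0 1)) := by
  have hd : Differentiable ℝ (fun x : ℝ => Real.log (f (Real.exp x))) := fun x =>
    (((hf_diff.differentiableAt (Ioi_mem_nhds (Real.exp_pos x))).comp x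
      Real.differentiableAt_exp).log (hf_pos _ (Real.exp_pos x)).ne')
  have mono {D E : Set ℝ} (hD : Convex ℝ D) (hE : ∀ x ∈ E, 0 < x ∧ Real.log x ∈ D)
      (h : ∀ t ∈ D, 0 ≤ c * (c * t - t)) :
      MonotoneOn (fun x : ℝ => f (x ^ c) / (f x) ^ c) E := by
    intro x hx y hy hxy
    simp only [div_rpow_eq_exp_log_comp_exp hf_pos c (hE x hx).1,
      div_rpow_eq_exp_log_comp_exp hf_pos c (hE y hy).1]
    exact Real.exp_le_exp.2 (hconv.monotoneOn_comp_mul_sub_mul hd hD h (hE x hx).2 (hE y hy).2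
      (Real.log_le_log (hE x hx).1 hxy))
  have anti {D E : Set ℝ} (hD : Convex ℝ D) (hE : ∀ x ∈ E, 0 < x ∧ Real.log x ∈ D)
      (h : ∀ t ∈ D, c * (c * t - t) ≤ 0) :
      AntitoneOn (fun x : ℝ => f (x ^ c) / (f x) ^ c) E := by
    intro x hx y hy hxy
    simp only [div_rpow_eq_exp_log_comp_exp hf_pos c (hE x hx).1,
      div_rpow_eq_exp_log_comp_exp hf_pos c (hE y hy).1]
    exact Real.exp_le_exp.2 (hconv.antitoneOn_comp_mul_sub_mul hd hD h (hE x hx).2 (hE y hy).2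
      (Real.log_le_log (hE x hx).1 hxy))
  have hlt : ∀ x ∈ Set.Ioo (0 : ℝ) 1, 0 < x ∧ Real.log x ∈ Set.Iio 0 :=
    fun x hx => ⟨hx.1, Real.log_neg hx.1 hx.2⟩
  have hgt : ∀ x ∈ Set.Ioi (1 : ℝ), 0 < x ∧ Real.log x ∈ Set.Ioi 0 :=
    fun x hx => ⟨zero_lt_one.trans hx, Real.log_pos hx⟩
  have factor (t : ℝ) : c * (c * t - t) = c * (c - 1) * t := by ring
  have hneg (h : 0 < c ∧ c < 1) : c * (c - 1) ≤ 0 := by nlinarith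
  have hpos (h : 1 < c) : 0 ≤ c * (c - 1) := by nlinarith
  have hpos' (h : c < 0) : 0 ≤ c * (c - 1) := by nlinarith
  simp only [factor] at mono anti
  exact ⟨fun h => mono (convex_Iio 0) hlt fun t ht =>
      mul_nonneg_of_nonpos_of_nonpos (hneg h) (le_of_lt ht),
    fun h => mono (convex_Ioi 0) hgt fun t ht => mul_nonneg (hpos h) (le_of_lt ht),
    fun h => mono (convex_Ioi 0) hgt fun t ht => mul_nonneg (hpos' h) (le_of_lt ht),
    fun h => anti (convex_Ioi 0) hgt fun t ht =>
      mul_nonpos_of_nonpos_of_nonneg (hneg h) (le_of_lt ht),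
    fun h => anti (convex_Iio 0) hlt fun t ht =>
      mul_nonpos_of_nonneg_of_nonpos (hpos h) (le_of_lt ht),
    fun h => anti (convex_Iio 0) hlt fun t ht =>
      mul_nonpos_of_nonneg_of_nonpos (hpos' h) (le_of_lt ht)⟩
end

section
/- Let c, d > 0 satisfy 1/c + 1/d ≥ 1. For r ∈ (0,1) and p > 0 define ω(c,d,p,r) = ( (r^p/(1+r^p)) · F(c,d;c+d; r^p/(1+r^p)) )^{1/p}. Then for each fixed r ∈ (0,1), the function p ↦ ω(c,d,p,r) is strictly increasing on (0,∞). -/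
/-- The Gaussian hypergeometric function `₂F₁(a,b;c;x)` defined by its Maclaurin
series `∑ (a)ₙ(b)ₙ/((c)ₙ n!) xⁿ`, where `(a)ₙ` is the rising factorial. -/
noncomputable def hypergeom (a b c x : ℝ) : ℝ :=
  ∑' n : ℕ, ((∏ k ∈ Finset.range n, (a + k)) * (∏ k ∈ Finset.range n, (b + k)) /
      ((∏ k ∈ Finset.range n, (c + k)) * (Nat.factorial n))) * x ^ n

/-- The Maclaurin coefficients of `₂F₁(c,d;c+d;x)`. -/
noncomputable def zeroBalancedCoeff (c d : ℝ) (n : ℕ) : ℝ :=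
  ((∏ k ∈ Finset.range n, (c + k)) * ∏ k ∈ Finset.range n, (d + k)) /
    ((∏ k ∈ Finset.range n, (c + d + k)) * (Nat.factorial n))

lemma zeroBalancedCoeff_pos {c d : ℝ} (hc : 0 < c) (hd : 0 < d) (n : ℕ) :
    0 < zeroBalancedCoeff c d n := by
  unfold zeroBalancedCoeff
  have h : ∀ a : ℝ, 0 < a → 0 < ∏ k ∈ Finset.range n, (a + k) := fun a ha =>
    Finset.prod_pos fun k _ => by positivity
  have h₁ := h c hc
  have h₂ := h d hd
  have h₃ := h (c + d) (by positivity)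
  positivity

lemma zeroBalancedCoeff_succ (c d : ℝ) (n : ℕ) :
    zeroBalancedCoeff c d (n + 1) =
      zeroBalancedCoeff c d n * ((c + n) * (d + n) / ((c + d + n) * (n + 1))) := by
  simp only [zeroBalancedCoeff, Finset.prod_range_succ, Nat.factorial_succ, Nat.cast_mul,
    Nat.cast_add, Nat.cast_one]
  rw [div_mul_div_comm]
  congr 1 <;> ring

lemma zeroBalancedCoeff_sub_succ {c d : ℝ} (hc : 0 < c) (hd : 0 < d) (n : ℕ) :
    zeroBalancedCoeff c d n - zeroBalancedCoeff c d (n + 1) =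
      zeroBalancedCoeff c d n * ((c + d - c * d + n) / ((c + d + n) * (n + 1))) := by
  rw [zeroBalancedCoeff_succ]
  have : c + d + n ≠ 0 := by positivity
  field_simp
  ring

lemma zeroBalancedCoeff_succ_le {c d : ℝ} (hc : 0 < c) (hd : 0 < d) (hcd : c * d ≤ c + d)
    (n : ℕ) : zeroBalancedCoeff c d (n + 1) ≤ zeroBalancedCoeff c d n := by
  rw [← sub_nonneg, zeroBalancedCoeff_sub_succ hc hd]
  have := zeroBalancedCoeff_pos hc hd n
  have : 0 ≤ c + d - c * d := by linarith
  positivity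

lemma zeroBalancedCoeff_two_lt_one {c d : ℝ} (hc : 0 < c) (hd : 0 < d) (hcd : c * d ≤ c + d) :
    zeroBalancedCoeff c d 2 < zeroBalancedCoeff c d 1 := by
  rw [← sub_pos, zeroBalancedCoeff_sub_succ hc hd]
  have := zeroBalancedCoeff_pos hc hd 1
  have : 0 < c + d - c * d + (1 : ℕ) := by push_cast; linarith
  positivity

lemma zeroBalancedCoeff_zero (c d : ℝ) : zeroBalancedCoeff c d 0 = 1 := by
  simp [zeroBalancedCoeff]

lemma summable_zeroBalancedCoeff {c d : ℝ} (hc : 0 < c) (hd : 0 < d) (hcd : c * d ≤ c + d)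
    {x : ℝ} (hx0 : 0 < x) (hx1 : x < 1) :
    Summable fun n => zeroBalancedCoeff c d n * x ^ n := by
  have anti := antitone_nat_of_succ_le (zeroBalancedCoeff_succ_le hc hd hcd)
  refine Summable.of_nonneg_of_le
    (fun n => mul_nonneg (zeroBalancedCoeff_pos hc hd n).le (by positivity)) (fun n => ?_)
    (summable_geometric_of_lt_one hx0.le hx1)
  have := anti (Nat.zero_le n)
  rw [zeroBalancedCoeff_zero] at this
  exact mul_le_of_le_one_left (by positivity) this

/-- The Maclaurin expansion of `1 - (1 - x) * F(c,d;c+d;x)`. -/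
lemma hasSum_one_sub_one_sub_mul_hypergeom {c d : ℝ} (hc : 0 < c) (hd : 0 < d)
    (hcd : c * d ≤ c + d) {x : ℝ} (hx0 : 0 < x) (hx1 : x < 1) :
    HasSum (fun n => (zeroBalancedCoeff c d n - zeroBalancedCoeff c d (n + 1)) * x ^ (n + 1))
      (1 - (1 - x) * hypergeom c d (c + d) x) := by
  have hF : HasSum (fun n => zeroBalancedCoeff c d n * x ^ n) (hypergeom c d (c + d) x) :=
    (summable_zeroBalancedCoeff hc hd hcd hx0 hx1).hasSum
  have hshift := (hasSum_nat_add_iff' 1).mpr hF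
  simp only [Finset.range_one, Finset.sum_singleton, zeroBalancedCoeff_zero, pow_zero] at hshift
  have h := (hF.mul_left x).sub hshift
  rw [show x * hypergeom c d (c + d) x - (hypergeom c d (c + d) x - 1 * 1) =
    1 - (1 - x) * hypergeom c d (c + d) x by ring] at h
  simpa only [mul_left_comm x, ← pow_succ', ← sub_mul] using h

lemma hypergeom_pos {c d : ℝ} (hc : 0 < c) (hd : 0 < d) (hcd : c * d ≤ c + d) {x : ℝ}
    (hx0 : 0 < x) (hx1 : x < 1) : 0 < hypergeom c d (c + d) x :=
  (summable_zeroBalancedCoeff hc hd hcd hx0 hx1).tsum_pos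
    (fun n => mul_nonneg (zeroBalancedCoeff_pos hc hd n).le (by positivity)) 0
    (mul_pos (zeroBalancedCoeff_pos hc hd 0) (by positivity))

lemma one_sub_mul_hypergeom_le_one {c d : ℝ} (hc : 0 < c) (hd : 0 < d) (hcd : c * d ≤ c + d)
    {x : ℝ} (hx0 : 0 < x) (hx1 : x < 1) : (1 - x) * hypergeom c d (c + d) x ≤ 1 := by
  rw [← sub_nonneg]
  exact (hasSum_one_sub_one_sub_mul_hypergeom hc hd hcd hx0 hx1).nonneg fun n =>
    mul_nonneg (sub_nonneg.mpr (zeroBalancedCoeff_succ_le hc hd hcd n)) (by positivity)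

lemma one_sub_mul_hypergeom_strictAntiOn {c d : ℝ} (hc : 0 < c) (hd : 0 < d)
    (hcd : c * d ≤ c + d) :
    StrictAntiOn (fun x => (1 - x) * hypergeom c d (c + d) x) (Set.Ioo 0 1) := by
  rintro x ⟨hx0, hx1⟩ y ⟨hy0, hy1⟩ hxy
  have key := hasSum_lt (i := 1) (fun n => ?_) ?_
    (hasSum_one_sub_one_sub_mul_hypergeom hc hd hcd hx0 hx1)
    (hasSum_one_sub_one_sub_mul_hypergeom hc hd hcd hy0 hy1)
  · simp only
    linarith
  · have := sub_nonneg.mpr (zeroBalancedCoeff_succ_le hc hd hcd n)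
    dsimp only
    gcongr
  · have := sub_pos.mpr (zeroBalancedCoeff_two_lt_one hc hd hcd)
    gcongr

/-- Theorem 1.5 (second main result): for `c, d > 0` with `1/c + 1/d ≥ 1`, the function
`p ↦ ω(c,d,p,r) = ((r^p/(1+r^p))·F(c,d;c+d;r^p/(1+r^p)))^(1/p)` is strictly increasing
on `(0,∞)` for each fixed `r ∈ (0,1)`. -/
theorem omega_strictMono (c d : ℝ) (hc : 0 < c) (hd : 0 < d) (hcd : 1 ≤ 1 / c + 1 / d)
    (r : ℝ) (hr0 : 0 < r) (hr1 : r < 1) :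
    StrictMonoOn (fun p : ℝ =>
        (r ^ p / (1 + r ^ p) * hypergeom c d (c + d) (r ^ p / (1 + r ^ p))) ^ (1 / p))
      (Set.Ioi 0) := by
  have hcd' : c * d ≤ c + d := by
    rw [div_add_div _ _ hc.ne' hd.ne', le_div_iff₀ (by positivity)] at hcd
    linarith
  have hmem : ∀ p : ℝ, r ^ p / (1 + r ^ p) ∈ Set.Ioo (0 : ℝ) 1 := fun p => by
    have : 0 < r ^ p := by positivity
    exact ⟨by positivity, by rw [div_lt_one (by positivity)]; linarith⟩
  set φ : ℝ → ℝ := fun x => (1 - x) * hypergeom c d (c + d) x with hφ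
  have hφ_pos : ∀ p : ℝ, 0 < φ (r ^ p / (1 + r ^ p)) := fun p =>
    mul_pos (sub_pos.mpr (hmem p).2) (hypergeom_pos hc hd hcd' (hmem p).1 (hmem p).2)
  have hω : ∀ p : ℝ, 0 < p →
      (r ^ p / (1 + r ^ p) * hypergeom c d (c + d) (r ^ p / (1 + r ^ p))) ^ (1 / p) =
        r * φ (r ^ p / (1 + r ^ p)) ^ (1 / p) := fun p hp => by
    have hrp : 0 < r ^ p := by positivity
    have h : r ^ p / (1 + r ^ p) * hypergeom c d (c + d) (r ^ p / (1 + r ^ p)) =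
        r ^ p * φ (r ^ p / (1 + r ^ p)) := by
      have : 1 - r ^ p / (1 + r ^ p) = 1 / (1 + r ^ p) := by
        field_simp
        ring
      simp only [hφ, this]
      ring
    rw [h, Real.mul_rpow hrp.le (hφ_pos p).le, ← Real.rpow_mul hr0.le,
      mul_one_div_cancel hp.ne', Real.rpow_one]
  intro p hp q hq hpq
  rw [Set.mem_Ioi] at hp hq
  simp only [hω p hp, hω q hq]
  have hlt : r ^ q / (1 + r ^ q) < r ^ p / (1 + r ^ p) := by
    have := Real.rpow_lt_rpow_of_exponent_gt hr0 hr1 hpq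
    have : 0 < r ^ q := by positivity
    rw [div_lt_div_iff₀ (by positivity) (by positivity)]
    linarith
  refine mul_lt_mul_of_pos_left ?_ hr0
  calc φ (r ^ p / (1 + r ^ p)) ^ (1 / p)
      < φ (r ^ q / (1 + r ^ q)) ^ (1 / p) :=
        Real.rpow_lt_rpow (hφ_pos p).le
          (one_sub_mul_hypergeom_strictAntiOn hc hd hcd' (hmem q) (hmem p) hlt) (by positivity)
    _ ≤ φ (r ^ q / (1 + r ^ q)) ^ (1 / q) :=
        Real.rpow_le_rpow_of_exponent_ge (hφ_pos q)
          (one_sub_mul_hypergeom_le_one hc hd hcd' (hmem q).1 (hmem q).2)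
          (one_div_le_one_div_of_le hp hpq.le)
end

section
/- Let c, d > 0 satisfy 1/c + 1/d ≥ 1. Then for every r ∈ (0,1), (√r/(1+√r)) · F(c,d;c+d; √r/(1+√r)) ≤ ( (r/(1+r)) · F(c,d;c+d; r/(1+r)) )^{1/2}. -/
lemma summable_mul_pow_of_antitone {a : ℕ → ℝ} (ha : Antitone a) (h0 : ∀ n, 0 ≤ a n)
    {x : ℝ} (hx : x ∈ Set.Ico (0 : ℝ) 1) : Summable fun n => a n * x ^ n := by
  refine Summable.of_nonneg_of_le (fun n => mul_nonneg (h0 n) (pow_nonneg hx.1 n))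
    (fun n => mul_le_mul_of_nonneg_right (ha (Nat.zero_le n)) (pow_nonneg hx.1 n))
    ((summable_geometric_of_lt_one hx.1 hx.2).mul_left (a 0))

/-- A summation by parts: `1 - x` times a power series with antitone nonnegative coefficients. -/
lemma hasSum_sub_mul_pow_succ {a : ℕ → ℝ} (ha : Antitone a) (h0 : ∀ n, 0 ≤ a n)
    {x : ℝ} (hx : x ∈ Set.Ico (0 : ℝ) 1) :
    HasSum (fun n => (a n - a (n + 1)) * x ^ (n + 1)) (a 0 - (1 - x) * ∑' n, a n * x ^ n) := by
  have hs := summable_mul_pow_of_antitone ha h0 hx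
  have hshift := (hasSum_nat_add_iff' (f := fun n => a n * x ^ n) 1).2 hs.hasSum
  rw [Finset.sum_range_one, pow_zero] at hshift
  rw [show a 0 - (1 - x) * ∑' n, a n * x ^ n =
    x * ∑' n, a n * x ^ n - (∑' n, a n * x ^ n - a 0 * 1) by ring]
  have hdiff : (fun n => (a n - a (n + 1)) * x ^ (n + 1)) =
      fun n => x * (a n * x ^ n) - a (n + 1) * x ^ (n + 1) := by
    ext n
    ring
  rw [hdiff]
  exact (hs.hasSum.mul_left x).sub hshift

lemma antitoneOn_one_sub_mul_tsum_mul_pow {a : ℕ → ℝ} (ha : Antitone a) (h0 : ∀ n, 0 ≤ a n) :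
    AntitoneOn (fun x : ℝ => (1 - x) * ∑' n, a n * x ^ n) (Set.Ico 0 1) := by
  intro y hy x hx hyx
  have h := hasSum_le (fun n => mul_le_mul_of_nonneg_left (pow_le_pow_left₀ hy.1 hyx (n + 1))
    (sub_nonneg.2 (ha n.le_succ))) (hasSum_sub_mul_pow_succ ha h0 hy)
    (hasSum_sub_mul_pow_succ ha h0 hx)
  exact (sub_le_sub_iff_left _).1 h

lemma hypergeom_zero (a b c : ℝ) : hypergeom a b c 0 = 1 := by
  rw [hypergeom, tsum_eq_single 0 (fun n hn => by simp [hn])]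
  simp

lemma antitoneOn_one_sub_mul_hypergeom {c d : ℝ} (hc : 0 < c) (hd : 0 < d)
    (hcd : c * d ≤ c + d) :
    AntitoneOn (fun x : ℝ => (1 - x) * hypergeom c d (c + d) x) (Set.Ico 0 1) := by
  have hpos : ∀ n : ℕ, 0 ≤ (∏ k ∈ Finset.range n, (c + k)) * (∏ k ∈ Finset.range n, (d + k)) /
      ((∏ k ∈ Finset.range n, (c + d + k)) * (Nat.factorial n)) := fun n => by positivity
  refine antitoneOn_one_sub_mul_tsum_mul_pow (antitone_nat_of_succ_le fun n => ?_) hpos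
  have hratio : (c + n) * (d + n) / ((c + d + n) * (n + 1)) ≤ 1 := by
    have hn : (0 : ℝ) ≤ n := n.cast_nonneg
    rw [div_le_one (by positivity)]
    nlinarith
  refine le_trans (le_of_eq ?_) (mul_le_of_le_one_right (hpos n) hratio)
  rw [div_mul_div_comm, Finset.prod_range_succ, Finset.prod_range_succ, Finset.prod_range_succ,
    Nat.factorial_succ]
  push_cast
  congr 1 <;> ring

/-- Special case of Theorem 1.5: for `c, d > 0` with `1/c + 1/d ≥ 1` and `r ∈ (0,1)`,
`(√r/(1+√r))·F(c,d;c+d;√r/(1+√r)) ≤ ((r/(1+r))·F(c,d;c+d;r/(1+r)))^(1/2)`. -/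
theorem hypergeom_sqrt_ineq (c d : ℝ) (hc : 0 < c) (hd : 0 < d) (hcd : 1 ≤ 1 / c + 1 / d)
    (r : ℝ) (hr0 : 0 < r) (hr1 : r < 1) :
    Real.sqrt r / (1 + Real.sqrt r) *
        hypergeom c d (c + d) (Real.sqrt r / (1 + Real.sqrt r)) ≤
      (r / (1 + r) * hypergeom c d (c + d) (r / (1 + r))) ^ ((1 : ℝ) / 2) := by
  have hcd' : c * d ≤ c + d := by
    rw [div_add_div _ _ hc.ne' hd.ne', le_div_iff₀ (by positivity)] at hcd
    linarith
  have hanti := antitoneOn_one_sub_mul_hypergeom hc hd hcd'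
  have hmem : ∀ t : ℝ, 0 < t → t / (1 + t) ∈ Set.Ico (0 : ℝ) 1 := fun t ht =>
    ⟨by positivity, (div_lt_one (by positivity)).2 (by linarith)⟩
  have hfactor : ∀ t : ℝ, 0 < t → t / (1 + t) * hypergeom c d (c + d) (t / (1 + t)) =
      t * ((1 - t / (1 + t)) * hypergeom c d (c + d) (t / (1 + t))) := fun t ht => by
    field_simp
    ring
  have hs0 : 0 < √r := Real.sqrt_pos.2 hr0
  have hrs : r ≤ √r := Real.le_sqrt_self_iff.2 hr1.le
  have hle : r / (1 + r) ≤ √r / (1 + √r) := by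
    rw [div_le_div_iff₀ (by positivity) (by positivity)]
    linarith
  have hmono := hanti (hmem r hr0) (hmem (√r) hs0) hle
  have hone := hanti ⟨le_rfl, one_pos⟩ (hmem (√r) hs0) (hmem (√r) hs0).1
  simp only [hypergeom_zero, sub_zero, mul_one] at hmono hone
  rw [← Real.sqrt_eq_rpow, hfactor r hr0, hfactor (√r) hs0, Real.sqrt_mul hr0.le]
  refine mul_le_mul_of_nonneg_left ?_ hs0.le
  have hnonneg : 0 ≤ (1 - √r / (1 + √r)) * hypergeom c d (c + d) (√r / (1 + √r)) := by
    refine mul_nonneg (sub_nonneg.2 (hmem _ hs0).2.le) (tsum_nonneg fun n => ?_)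
    positivity
  refine Real.le_sqrt_of_sq_le (le_trans ?_ hmono)
  nlinarith
end

section
/- Let c, d ∈ (0,1], let B = Γ(c)Γ(d)/Γ(c+d), and for x ∈ (0,1) define h(x) = x·F(c,d;c+d;x) / log(1/(1-x)). Let p ≥ 1, x ∈ (0,1), and z = 1 - (1-x)^{1/p}. Then B ≥ B·h(z) ≥ B·h(x) ≥ 1 and F(c,d;c+d;z) ≥ (1/p)·F(c,d;c+d;x). -/
open Finset Filter Topology

/-- If `r` is antitone and `b` is nonnegative, the ratio of the power series with coefficients
`r n * b n` and `b n` is antitone on the positive reals. -/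
theorem HasSum.mul_le_mul_of_antitone_coeff {r b : ℕ → ℝ} (hr : Antitone r) (hb : ∀ n, 0 ≤ b n)
    {z x Nz Dz Nx Dx : ℝ} (hz : 0 ≤ z) (hzx : z ≤ x) (hx : 0 < x) (hDx : 0 < Dx)
    (hNz : HasSum (fun n => r n * (b n * z ^ n)) Nz) (hDz : HasSum (fun n => b n * z ^ n) Dz)
    (hNx : HasSum (fun n => r n * (b n * x ^ n)) Nx) (hDx' : HasSum (fun n => b n * x ^ n) Dx) :
    Nx / Dx * Dz ≤ Nz := by
  set l := Nx / Dx with hl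
  have hx_sum : HasSum (fun n => (r n - l) * (b n * x ^ n)) 0 := by
    have h := hNx.sub (hDx'.mul_left l)
    have h0 : Nx - l * Dx = 0 := by rw [hl]; field_simp; ring
    rw [h0] at h
    exact h.congr_fun fun n => by ring
  have hz_sum : HasSum (fun n => (r n - l) * (b n * z ^ n)) (Nz - l * Dz) :=
    (hNz.sub (hDz.mul_left l)).congr_fun fun n => by ring
  rw [← sub_nonneg]
  by_cases hall : ∀ n, l ≤ r n
  · exact hz_sum.nonneg fun n =>
      mul_nonneg (sub_nonneg.2 (hall n)) (mul_nonneg (hb n) (pow_nonneg hz n))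
  · push Not at hall
    classical
    set k := Nat.find hall
    have hk : r k < l := Nat.find_spec hall
    set q := z / x with hq
    have hq0 : 0 ≤ q := div_nonneg hz hx.le
    have hq1 : q ≤ 1 := (div_le_one hx).2 hzx
    have hle := hasSum_le (fun n => ?_) (hx_sum.mul_left (q ^ k)) hz_sum
    · simpa using hle
    · have hzq : z = q * x := by rw [hq]; field_simp
      have key : 0 ≤ (r n - l) * (q ^ n - q ^ k) := by
        rcases lt_or_ge n k with hn | hn
        · exact mul_nonneg (sub_nonneg.2 (not_lt.1 (Nat.find_min hall hn)))
            (sub_nonneg.2 (pow_le_pow_of_le_one hq0 hq1 hn.le))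
        · exact mul_nonneg_of_nonpos_of_nonpos (sub_nonpos.2 ((hr hn).trans hk.le))
            (sub_nonpos.2 (pow_le_pow_of_le_one hq0 hq1 hn))
      have := mul_nonneg key (mul_nonneg (hb n) (pow_nonneg hx.le n))
      rw [hzq, mul_pow]
      linarith

theorem prod_range_add_natCast_pos {a : ℝ} (ha : 0 < a) (n : ℕ) :
    0 < ∏ k ∈ range n, (a + k) :=
  prod_pos fun _ _ => by positivity

/-- The quotient of the `n`-th Maclaurin coefficients of `F(c,d;c+d;x)` and
`log(1/(1-x))/x`. -/
noncomputable def hypergeomLogCoeffRatio (c d : ℝ) (n : ℕ) : ℝ :=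
  (n + 1) * ((∏ k ∈ range n, (c + k)) * (∏ k ∈ range n, (d + k)) /
    ((∏ k ∈ range n, (c + d + k)) * (Nat.factorial n)))

theorem hypergeomLogCoeffRatio_zero (c d : ℝ) : hypergeomLogCoeffRatio c d 0 = 1 := by
  simp [hypergeomLogCoeffRatio]

theorem hypergeomLogCoeffRatio_pos {c d : ℝ} (hc : 0 < c) (hd : 0 < d) (n : ℕ) :
    0 < hypergeomLogCoeffRatio c d n := by
  have h1 := prod_range_add_natCast_pos hc n
  have h2 := prod_range_add_natCast_pos hd n
  have h3 := prod_range_add_natCast_pos (add_pos hc hd) n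
  unfold hypergeomLogCoeffRatio
  positivity

theorem hypergeomLogCoeffRatio_antitone {c d : ℝ} (hc : 0 < c) (hc1 : c ≤ 1) (hd : 0 < d)
    (hd1 : d ≤ 1) : Antitone (hypergeomLogCoeffRatio c d) := by
  refine antitone_nat_of_succ_le fun n => ?_
  have h3 := prod_range_add_natCast_pos (add_pos hc hd) n
  have hstep : hypergeomLogCoeffRatio c d (n + 1) = hypergeomLogCoeffRatio c d n *
      (((c + n) * (d + n) * (n + 2)) / ((c + d + n) * (n + 1) ^ 2)) := by
    unfold hypergeomLogCoeffRatio
    rw [prod_range_succ, prod_range_succ, prod_range_succ, Nat.factorial_succ]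
    push_cast
    field_simp
    ring
  rw [hstep]
  refine mul_le_of_le_one_right (hypergeomLogCoeffRatio_pos hc hd n).le ?_
  rw [div_le_one (by positivity)]
  have hcd_le_c : c * d ≤ c := mul_le_of_le_one_right hc.le hd1
  have hcd_le_d : c * d ≤ d := mul_le_of_le_one_left hd.le hc1
  have : 0 ≤ (1 - c * d) * (n : ℝ) := mul_nonneg (by linarith) n.cast_nonneg
  nlinarith

theorem tendsto_hypergeomLogCoeffRatio {c d : ℝ} (hc : 0 < c) (hd : 0 < d) :
    Tendsto (hypergeomLogCoeffRatio c d) atTop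
      (𝓝 (Real.Gamma (c + d) / (Real.Gamma c * Real.Gamma d))) := by
  have hgc := (Real.Gamma_pos_of_pos hc).ne'
  have hgd := (Real.Gamma_pos_of_pos hd).ne'
  rw [← tendsto_add_atTop_iff_nat 1]
  have h1 := (Real.GammaSeq_tendsto_Gamma (c + d)).div
    ((Real.GammaSeq_tendsto_Gamma c).mul (Real.GammaSeq_tendsto_Gamma d)) (mul_ne_zero hgc hgd)
  have h2 : Tendsto (fun n : ℕ => 1 + 1 / ((n : ℝ) + 1)) atTop (𝓝 (1 + 0)) :=
    tendsto_const_nhds.add tendsto_one_div_add_atTop_nhds_zero_nat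
  have h3 := h1.mul h2
  rw [add_zero, mul_one] at h3
  refine h3.congr' ?_
  filter_upwards [eventually_gt_atTop 0] with n hn
  have hn' : (0 : ℝ) < n := by exact_mod_cast hn
  have p1 := prod_range_add_natCast_pos hc (n + 1)
  have p2 := prod_range_add_natCast_pos hd (n + 1)
  have p3 := prod_range_add_natCast_pos (add_pos hc hd) (n + 1)
  have e1 := Real.rpow_pos_of_pos hn' c
  have e2 := Real.rpow_pos_of_pos hn' d
  simp only [Pi.div_apply, Real.GammaSeq, hypergeomLogCoeffRatio, Real.rpow_add hn',
    Nat.factorial_succ]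
  push_cast
  field_simp

theorem hasSum_log_one_sub_div {x : ℝ} (hx0 : 0 < x) (hx1 : x < 1) :
    HasSum (fun n : ℕ => 1 / ((n : ℝ) + 1) * x ^ n) (Real.log (1 / (1 - x)) / x) := by
  have h := (Real.hasSum_pow_div_log_of_abs_lt_one
    (abs_lt.2 ⟨by linarith, hx1⟩)).div_const x
  rw [one_div, Real.log_inv]
  exact h.congr_fun fun n => by rw [pow_succ]; field_simp

theorem log_one_div_one_sub_pos {x : ℝ} (hx0 : 0 < x) (hx1 : x < 1) :
    0 < Real.log (1 / (1 - x)) :=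
  Real.log_pos ((one_lt_div (by linarith)).2 (by linarith))

theorem hasSum_hypergeom_add {c d : ℝ} (hc : 0 < c) (hc1 : c ≤ 1) (hd : 0 < d) (hd1 : d ≤ 1)
    {x : ℝ} (hx0 : 0 < x) (hx1 : x < 1) :
    HasSum (fun n : ℕ => hypergeomLogCoeffRatio c d n * (1 / ((n : ℝ) + 1) * x ^ n))
      (hypergeom c d (c + d) x) := by
  have hsum : Summable
      (fun n : ℕ => hypergeomLogCoeffRatio c d n * (1 / ((n : ℝ) + 1) * x ^ n)) := by
    refine Summable.of_nonneg_of_le (fun n => ?_) (fun n => ?_)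
      (hasSum_log_one_sub_div hx0 hx1).summable
    · have := hypergeomLogCoeffRatio_pos hc hd n
      positivity
    · refine mul_le_of_le_one_left (by positivity) ?_
      rw [← hypergeomLogCoeffRatio_zero c d]
      exact hypergeomLogCoeffRatio_antitone hc hc1 hd hd1 n.zero_le
  have heq : hypergeom c d (c + d) x =
      ∑' n : ℕ, hypergeomLogCoeffRatio c d n * (1 / ((n : ℝ) + 1) * x ^ n) := by
    refine tsum_congr fun n => ?_
    have h3 := prod_range_add_natCast_pos (add_pos hc hd) n
    unfold hypergeomLogCoeffRatio
    field_simp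
  rw [heq]
  exact hsum.hasSum

/-- Lemma 3.1: for `c, d ∈ (0,1]`, `B = Γ(c)Γ(d)/Γ(c+d)`,
`h(x) = x·F(c,d;c+d;x)/log(1/(1-x))`, `p ≥ 1`, `x ∈ (0,1)` and `z = 1-(1-x)^(1/p)`,
one has `B ≥ B·h(z) ≥ B·h(x) ≥ 1` and `F(c,d;c+d;z) ≥ (1/p)·F(c,d;c+d;x)`. -/
theorem hypergeom_log_ratio_bounds (c d : ℝ) (hc : 0 < c) (hc1 : c ≤ 1)
    (hd : 0 < d) (hd1 : d ≤ 1) (p : ℝ) (hp : 1 ≤ p) (x : ℝ) (hx0 : 0 < x) (hx1 : x < 1) :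
    let B : ℝ := Real.Gamma c * Real.Gamma d / Real.Gamma (c + d)
    let h : ℝ → ℝ := fun t => t * hypergeom c d (c + d) t / Real.log (1 / (1 - t))
    let z : ℝ := 1 - (1 - x) ^ (1 / p)
    B ≥ B * h z ∧ B * h z ≥ B * h x ∧ B * h x ≥ 1 ∧
      hypergeom c d (c + d) z ≥ (1 / p) * hypergeom c d (c + d) x := by
  intro B h z
  have hGc := Real.Gamma_pos_of_pos hc
  have hGd := Real.Gamma_pos_of_pos hd
  have hGcd := Real.Gamma_pos_of_pos (add_pos hc hd)
  have hB : 0 < B := by positivity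
  have hp0 : 0 < p := by linarith
  have hr := hypergeomLogCoeffRatio_antitone hc hc1 hd hd1
  have hz1 : z < 1 := sub_lt_self 1 (Real.rpow_pos_of_pos (by linarith) _)
  have hz0 : 0 < z :=
    sub_pos.2 (Real.rpow_lt_one (by linarith) (by linarith) (by positivity))
  have hzx : z ≤ x := by
    have := Real.rpow_le_rpow_of_exponent_ge (x := 1 - x) (by linarith) (by linarith)
      ((div_le_one hp0).2 hp)
    rw [Real.rpow_one] at this
    linarith
  have hLx := log_one_div_one_sub_pos hx0 hx1
  have hLz := log_one_div_one_sub_pos hz0 hz1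
  have hFx := hasSum_hypergeom_add hc hc1 hd hd1 hx0 hx1
  have hFz := hasSum_hypergeom_add hc hc1 hd hd1 hz0 hz1
  have hDx := hasSum_log_one_sub_div hx0 hx1
  have hDz := hasSum_log_one_sub_div hz0 hz1
  have h_one : h z ≤ 1 := by
    have hle : hypergeom c d (c + d) z ≤ Real.log (1 / (1 - z)) / z := by
      refine hasSum_le (fun n => mul_le_of_le_one_left (by positivity) ?_) hFz hDz
      rw [← hypergeomLogCoeffRatio_zero c d]
      exact hr n.zero_le
    rw [le_div_iff₀ hz0] at hle
    exact (div_le_one hLz).2 (by linarith)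
  have h_anti : h x ≤ h z := by
    have hle := HasSum.mul_le_mul_of_antitone_coeff hr (fun n => by positivity) hz0.le hzx hx0
      (div_pos hLx hx0) hFz hDz hFx hDx
    rw [← le_div_iff₀ (div_pos hLz hz0)] at hle
    rw [div_div_eq_mul_div, div_div_eq_mul_div, mul_comm _ x, mul_comm _ z] at hle
    exact hle
  have h_lower : 1 ≤ B * h x := by
    have hle : B⁻¹ * (Real.log (1 / (1 - x)) / x) ≤ hypergeom c d (c + d) x := by
      refine hasSum_le (fun n => mul_le_mul_of_nonneg_right ?_ (by positivity))
        (hDx.mul_left _) hFx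
      rw [inv_div]
      exact hr.le_of_tendsto (tendsto_hypergeomLogCoeffRatio hc hd) n
    rw [← mul_div_assoc, div_le_iff₀ hx0, inv_mul_le_iff₀ hB] at hle
    rw [← mul_div_assoc, le_div_iff₀ hLx]
    linarith
  have hlog : Real.log (1 / (1 - z)) = 1 / p * Real.log (1 / (1 - x)) := by
    simp only [z, sub_sub_cancel, one_div, Real.log_inv]
    rw [Real.log_rpow (by linarith)]
    ring
  refine ⟨mul_le_of_le_one_right hB.le h_one, mul_le_mul_of_nonneg_left h_anti hB.le,
    h_lower, ?_⟩
  have hFx0 : 0 ≤ hypergeom c d (c + d) x := hFx.nonneg fun n => by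
    have := hypergeomLogCoeffRatio_pos hc hd n
    positivity
  have hmain : 1 / p * (x * hypergeom c d (c + d) x) ≤ z * hypergeom c d (c + d) z := by
    simp only [h] at h_anti
    rw [le_div_iff₀ hLz, hlog] at h_anti
    calc _ = x * hypergeom c d (c + d) x / Real.log (1 / (1 - x)) *
          (1 / p * Real.log (1 / (1 - x))) := by field_simp
      _ ≤ _ := h_anti
  refine le_of_mul_le_mul_left (le_trans ?_ hmain) hz0
  calc z * (1 / p * hypergeom c d (c + d) x)
      ≤ x * (1 / p * hypergeom c d (c + d) x) := by gcongr
    _ = _ := by ring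
end

section
/- Let c, d > 0 and define g(x) = x·F(c,d;c+d;x) for x ∈ (0,1). The function G(u) = log g(e^u/(1+e^u)) is concave on (-∞, +∞) if and only if 1/c + 1/d ≥ 1. -/
/-- The `n`-th Maclaurin coefficient of `₂F₁(c,d;c+d;x)`. -/
noncomputable def balancedCoeff (c d : ℝ) (n : ℕ) : ℝ :=
  (∏ k ∈ Finset.range n, (c + k)) * (∏ k ∈ Finset.range n, (d + k)) /
    ((∏ k ∈ Finset.range n, (c + d + k)) * (Nat.factorial n))

/-- The power series of `(1 - x) dF/dx`, where `F(x) = ₂F₁(c,d;c+d;x)`. -/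
noncomputable def balancedDerivNumerator (c d x : ℝ) : ℝ :=
  ∑' n : ℕ, balancedCoeff c d n * (c * d / (c + d + n)) * x ^ n

lemma hypergeom_balanced_eq (c d x : ℝ) :
    hypergeom c d (c + d) x = ∑' n : ℕ, balancedCoeff c d n * x ^ n := rfl

lemma balancedCoeff_zero (c d : ℝ) : balancedCoeff c d 0 = 1 := by
  simp [balancedCoeff]

section

variable {c d : ℝ} (hc : 0 < c) (hd : 0 < d)
include hc hd

lemma balancedCoeff_pos (n : ℕ) : 0 < balancedCoeff c d n := by
  unfold balancedCoeff
  have h1 : 0 < ∏ k ∈ Finset.range n, (c + k) := Finset.prod_pos fun _ _ => by positivity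
  have h2 : 0 < ∏ k ∈ Finset.range n, (d + k) := Finset.prod_pos fun _ _ => by positivity
  have h3 : 0 < ∏ k ∈ Finset.range n, (c + d + k) := Finset.prod_pos fun _ _ => by positivity
  positivity

lemma balancedCoeff_succ (n : ℕ) :
    (n + 1) * balancedCoeff c d (n + 1) =
      n * balancedCoeff c d n + balancedCoeff c d n * (c * d / (c + d + n)) := by
  unfold balancedCoeff
  have h3 : 0 < ∏ k ∈ Finset.range n, (c + d + k) := Finset.prod_pos fun _ _ => by positivity
  have h4 : 0 < c + d + n := by positivity
  simp only [Finset.prod_range_succ, Nat.factorial_succ]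
  push_cast
  field_simp
  ring

lemma balanced_ratio_le (n : ℕ) : c * d / (c + d + n) ≤ c * d / (c + d) := by
  exact div_le_div_of_nonneg_left (by positivity) (by positivity) (by simp)

lemma balancedCoeff_succ_le {k : ℕ} (hk : c * d / (c + d) ≤ k) (n : ℕ) :
    (n + 1) * balancedCoeff c d (n + 1) ≤ (n + k + 1) * balancedCoeff c d n := by
  rw [balancedCoeff_succ hc hd]
  have h := balanced_ratio_le hc hd n
  nlinarith [balancedCoeff_pos hc hd n]

lemma balancedCoeff_le_choose {k : ℕ} (hk : c * d / (c + d) ≤ k) (n : ℕ) :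
    balancedCoeff c d n ≤ (n + k).choose k := by
  induction n with
  | zero => simp [balancedCoeff_zero]
  | succ n ih =>
    have h := balancedCoeff_succ_le hc hd hk n
    have e : (n + k).choose k * (n + k + 1) = (n + 1 + k).choose k * (n + 1) := by
      have := Nat.choose_mul_succ_eq (n + k) k
      rw [show n + k + 1 - k = n + 1 by omega, show n + k + 1 = n + 1 + k by omega] at this
      rw [← this]
      ring
    have e' : ((n + k).choose k : ℝ) * (n + k + 1) = (n + 1 + k).choose k * (n + 1) := by
      exact_mod_cast e
    have hn : (0 : ℝ) < n + 1 := by positivity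
    refine le_of_mul_le_mul_left ?_ hn
    calc _ ≤ _ := h
      _ ≤ (n + k + 1) * ((n + k).choose k : ℝ) := by gcongr
      _ = _ := by linarith

lemma summable_balancedCoeff {x : ℝ} (hx : |x| < 1) :
    Summable fun n : ℕ => balancedCoeff c d n * x ^ n := by
  obtain ⟨k, hk⟩ := exists_nat_ge (c * d / (c + d))
  refine Summable.of_norm_bounded
    (g := fun n : ℕ => ((n + k).choose k : ℝ) * |x| ^ n) ?_ fun n => ?_
  · exact summable_choose_mul_geometric_of_norm_lt_one k (r := |x|) (by simpa using hx)
  · rw [norm_mul, norm_pow, Real.norm_eq_abs, Real.norm_eq_abs,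
      abs_of_pos (balancedCoeff_pos hc hd n)]
    gcongr
    exact balancedCoeff_le_choose hc hd hk n

lemma summable_succ_mul_balancedCoeff {x : ℝ} (hx : |x| < 1) :
    Summable fun n : ℕ => (n + 1) * balancedCoeff c d (n + 1) * x ^ n := by
  obtain ⟨k, hk⟩ := exists_nat_ge (c * d / (c + d))
  refine Summable.of_norm_bounded
    (g := fun n : ℕ => (k + 1) * (((n + (k + 1)).choose (k + 1) : ℝ) * |x| ^ n)) ?_ fun n => ?_
  · exact (summable_choose_mul_geometric_of_norm_lt_one (k + 1) (r := |x|)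
      (by simpa using hx)).mul_left _
  · have hpos := balancedCoeff_pos hc hd (n + 1)
    rw [norm_mul, norm_pow, Real.norm_eq_abs, Real.norm_eq_abs, abs_of_pos (by positivity),
      ← mul_assoc]
    refine mul_le_mul_of_nonneg_right ?_ (by positivity)
    have e : ((n : ℝ) + k + 1) * (n + k).choose k = (n + (k + 1)).choose (k + 1) * (k + 1) := by
      exact_mod_cast Nat.add_one_mul_choose_eq (n + k) k
    calc _ ≤ _ := balancedCoeff_succ_le hc hd hk n
      _ ≤ (n + k + 1) * ((n + k).choose k : ℝ) := by
        gcongr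
        exact balancedCoeff_le_choose hc hd hk n
      _ = _ := by linarith

lemma summable_nat_mul_balancedCoeff {x : ℝ} (hx : |x| < 1) :
    Summable fun n : ℕ => balancedCoeff c d n * (n * x ^ (n - 1)) := by
  rw [← summable_nat_add_iff 1]
  refine (summable_succ_mul_balancedCoeff hc hd hx).congr fun n => ?_
  rw [Nat.add_sub_cancel]
  push_cast
  ring

lemma summable_balancedDerivNumerator {x : ℝ} (hx : |x| < 1) :
    Summable fun n : ℕ => balancedCoeff c d n * (c * d / (c + d + n)) * x ^ n := by
  refine Summable.of_norm_bounded
    ((summable_balancedCoeff hc hd (x := |x|) (by simpa using hx)).mul_left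
      (c * d / (c + d))) fun n => ?_
  have hpos := balancedCoeff_pos hc hd n
  rw [norm_mul, norm_pow, Real.norm_eq_abs, Real.norm_eq_abs, abs_of_pos (by positivity)]
  calc _ ≤ balancedCoeff c d n * (c * d / (c + d)) * |x| ^ n := by
        refine mul_le_mul_of_nonneg_right ?_ (by positivity)
        exact mul_le_mul_of_nonneg_left (balanced_ratio_le hc hd n) hpos.le
    _ = _ := by ring

lemma hasDerivAt_hypergeom_balanced {x : ℝ} (hx : |x| < 1) :
    HasDerivAt (hypergeom c d (c + d)) (balancedDerivNumerator c d x / (1 - x)) x := by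
  obtain ⟨r, hxr, hr⟩ := exists_between hx
  have hr0 : 0 ≤ r := (abs_nonneg x).trans hxr.le
  have hx1 : 1 - x ≠ 0 := by linarith [(abs_lt.1 hx).2]
  have key : HasDerivAt (fun z => ∑' n : ℕ, balancedCoeff c d n * z ^ n)
      (∑' n : ℕ, balancedCoeff c d n * (n * x ^ (n - 1))) x := by
    refine hasDerivAt_tsum_of_isPreconnected
      (summable_nat_mul_balancedCoeff hc hd (x := r) (by rwa [abs_of_nonneg hr0]))
      (Metric.isOpen_ball (x := (0 : ℝ)) (ε := r))
      (convex_ball (0 : ℝ) r).isPreconnected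
      (fun n y _ => (hasDerivAt_pow n y).const_mul _) (fun n y hy => ?_) (y₀ := x)
      (by simpa using hxr) (summable_balancedCoeff hc hd hx) (by simpa using hxr)
    have hpos := balancedCoeff_pos hc hd n
    have hy' : |y| ≤ r := by simpa using (mem_ball_zero_iff.1 hy).le
    rw [norm_mul, norm_mul, norm_pow, Real.norm_eq_abs, Real.norm_eq_abs, Real.norm_eq_abs,
      abs_of_pos hpos, Nat.abs_cast]
    gcongr
  refine key.congr_deriv (Eq.symm ?_)
  rw [div_eq_iff hx1, mul_sub, mul_one]
  have hs := summable_nat_mul_balancedCoeff hc hd hx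
  have e1 : ∑' n : ℕ, balancedCoeff c d n * (n * x ^ (n - 1)) =
      ∑' n : ℕ, (n + 1) * balancedCoeff c d (n + 1) * x ^ n := by
    rw [hs.tsum_eq_zero_add]
    simp only [Nat.cast_zero, zero_mul, mul_zero, zero_add, Nat.add_sub_cancel]
    refine tsum_congr fun n => ?_
    push_cast
    ring
  rw [← tsum_mul_right, e1, ← (summable_succ_mul_balancedCoeff hc hd hx).tsum_sub
    (hs.mul_right x)]
  refine tsum_congr fun n => ?_
  rw [balancedCoeff_succ hc hd]
  rcases n with _ | n
  · simp
  · simp [pow_succ]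
    ring

lemma one_le_hypergeom_balanced {x : ℝ} (hx0 : 0 ≤ x) (hx : x < 1) :
    1 ≤ hypergeom c d (c + d) x := by
  have hs := summable_balancedCoeff hc hd (x := x) (by rwa [abs_of_nonneg hx0])
  have := hs.le_tsum 0 fun n _ => mul_nonneg (balancedCoeff_pos hc hd n).le (pow_nonneg hx0 n)
  simpa [balancedCoeff_zero, hypergeom_balanced_eq] using this

lemma le_balancedDerivNumerator {x : ℝ} (hx0 : 0 ≤ x) (hx : x < 1) :
    c * d / (c + d) ≤ balancedDerivNumerator c d x := by
  have hs := summable_balancedDerivNumerator hc hd (x := x) (by rwa [abs_of_nonneg hx0])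
  have := hs.le_tsum 0 fun n _ => by
    have := balancedCoeff_pos hc hd n
    positivity
  simpa [balancedCoeff_zero, balancedDerivNumerator] using this

lemma balancedDerivNumerator_le {x : ℝ} (hx0 : 0 ≤ x) (hx : x < 1) :
    balancedDerivNumerator c d x ≤ c * d / (c + d) * hypergeom c d (c + d) x := by
  have hx' : |x| < 1 := by rwa [abs_of_nonneg hx0]
  rw [hypergeom_balanced_eq, ← tsum_mul_left]
  refine (summable_balancedDerivNumerator hc hd hx').tsum_le_tsum (fun n => ?_)
    ((summable_balancedCoeff hc hd hx').mul_left _)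
  have h := mul_nonneg (balancedCoeff_pos hc hd n).le (pow_nonneg hx0 n)
  nlinarith [mul_le_mul_of_nonneg_left (balanced_ratio_le hc hd n) h]

/-- The ratio of the power series `(1 - x) dF/dx` and `F(x)` is antitone, because the ratio of
their coefficients is. -/
lemma antitoneOn_balanced_ratio :
    AntitoneOn (fun x => balancedDerivNumerator c d x / hypergeom c d (c + d) x)
      (Set.Ioo 0 1) := by
  intro x hx y hy hxy
  have hx' : |x| < 1 := by rw [abs_of_pos hx.1]; exact hx.2
  have hy' : |y| < 1 := by rw [abs_of_pos hy.1]; exact hy.2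
  have hFx := one_le_hypergeom_balanced hc hd hx.1.le hx.2
  have hFy := one_le_hypergeom_balanced hc hd hy.1.le hy.2
  have hKx := le_balancedDerivNumerator hc hd hx.1.le hx.2
  have hp : 0 < c * d / (c + d) := by positivity
  set t := balancedDerivNumerator c d x / hypergeom c d (c + d) x with ht
  have htpos : 0 < t := div_pos (hp.trans_le hKx) (by linarith)
  have hsum : ∀ z : ℝ, |z| < 1 → HasSum
      (fun n : ℕ => balancedCoeff c d n * (c * d / (c + d + n) - t) * z ^ n)
      (balancedDerivNumerator c d z - t * hypergeom c d (c + d) z) := fun z hz => by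
    have h := (summable_balancedDerivNumerator hc hd hz).hasSum.sub
      ((summable_balancedCoeff hc hd hz).hasSum.mul_left t)
    refine (congrArg (fun f => HasSum f _) (funext fun n => ?_)).mp h
    ring
  have hzero : balancedDerivNumerator c d x - t * hypergeom c d (c + d) x = 0 := by
    rw [ht, div_mul_cancel₀ _ (by linarith), sub_self]
  have hq : 1 ≤ y / x := (one_le_div hx.1).2 hxy
  set θ := c * d / t - (c + d) with hθ
  have hle : balancedDerivNumerator c d y - t * hypergeom c d (c + d) y ≤
      (y / x) ^ θ * (balancedDerivNumerator c d x - t * hypergeom c d (c + d) x) := by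
    refine hasSum_le (fun n => ?_) (hsum y hy') ((hsum x hx').mul_left _)
    have hpos := mul_pos (balancedCoeff_pos hc hd n) (pow_pos hx.1 n)
    have hyn : y ^ n = x ^ n * (y / x) ^ (n : ℝ) := by
      rw [Real.rpow_natCast, div_pow, mul_div_cancel₀ _ (pow_pos hx.1 n).ne']
    have hcn : 0 < c + d + n := by positivity
    have hsign : (c * d / (c + d + n) - t) * ((y / x) ^ (n : ℝ) - (y / x) ^ θ) ≤ 0 := by
      rcases le_total (n : ℝ) θ with h | h
      · refine mul_nonpos_of_nonneg_of_nonpos ?_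
          (sub_nonpos.2 (Real.rpow_le_rpow_of_exponent_le hq h))
        rw [sub_nonneg, le_div_iff₀ hcn, ← le_div_iff₀' htpos]
        linarith
      · refine mul_nonpos_of_nonpos_of_nonneg ?_
          (sub_nonneg.2 (Real.rpow_le_rpow_of_exponent_le hq h))
        rw [sub_nonpos, div_le_iff₀ hcn, ← div_le_iff₀' htpos]
        linarith
    rw [hyn]
    nlinarith [mul_nonneg_of_nonpos_of_nonpos (neg_nonpos.2 hpos.le) hsign]
  rw [hzero, mul_zero] at hle
  show _ / _ ≤ t
  rw [div_le_iff₀ (by linarith)]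
  linarith

lemma hasDerivAt_log_hypergeom_logistic (u : ℝ) :
    HasDerivAt (fun u : ℝ => Real.log (Real.exp u / (1 + Real.exp u) *
          hypergeom c d (c + d) (Real.exp u / (1 + Real.exp u))))
      (1 - Real.exp u / (1 + Real.exp u) *
        (1 - balancedDerivNumerator c d (Real.exp u / (1 + Real.exp u)) /
          hypergeom c d (c + d) (Real.exp u / (1 + Real.exp u)))) u := by
  have he := Real.exp_pos u
  have hs : HasDerivAt (fun u : ℝ => Real.exp u / (1 + Real.exp u))
      (Real.exp u / (1 + Real.exp u) * (1 - Real.exp u / (1 + Real.exp u))) u := by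
    refine ((Real.hasDerivAt_exp u).div ((Real.hasDerivAt_exp u).const_add 1)
      (by positivity)).congr_deriv ?_
    field_simp
  have hx0 : 0 < Real.exp u / (1 + Real.exp u) := by positivity
  have hx1 : Real.exp u / (1 + Real.exp u) < 1 := by
    rw [div_lt_one (by positivity)]
    linarith
  have hF := one_le_hypergeom_balanced hc hd hx0.le hx1
  have hF' := hasDerivAt_hypergeom_balanced hc hd (x := Real.exp u / (1 + Real.exp u))
    (by rwa [abs_of_pos hx0])
  have hcomp := hF'.comp u hs
  refine ((hs.mul hcomp).log (mul_pos hx0 (zero_lt_one.trans_le hF)).ne').congr_deriv ?_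
  simp only [Function.comp, Pi.mul_apply]
  set x := Real.exp u / (1 + Real.exp u)
  have h1 : 1 - x ≠ 0 := by linarith
  have h2 : hypergeom c d (c + d) x ≠ 0 := by linarith
  have h3 : x ≠ 0 := hx0.ne'
  field_simp
  ring

end

lemma logistic_mem_Ioo (u : ℝ) : Real.exp u / (1 + Real.exp u) ∈ Set.Ioo (0 : ℝ) 1 := by
  have he := Real.exp_pos u
  refine ⟨by positivity, ?_⟩
  rw [div_lt_one (by positivity)]
  linarith

lemma logistic_le_logistic {u v : ℝ} (h : u ≤ v) :
    Real.exp u / (1 + Real.exp u) ≤ Real.exp v / (1 + Real.exp v) := by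
  have hu := Real.exp_pos u
  have hv := Real.exp_pos v
  have := Real.exp_le_exp.2 h
  rw [div_le_div_iff₀ (by positivity) (by positivity)]
  linarith

lemma exists_logistic_eq {x : ℝ} (hx : x ∈ Set.Ioo (0 : ℝ) 1) :
    ∃ u : ℝ, Real.exp u / (1 + Real.exp u) = x := by
  have h1 : 0 < 1 - x := by linarith [hx.2]
  refine ⟨Real.log (x / (1 - x)), ?_⟩
  rw [Real.exp_log (div_pos hx.1 h1)]
  field_simp
  ring

lemma one_le_inv_add_inv_iff {c d : ℝ} (hc : 0 < c) (hd : 0 < d) :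
    1 ≤ 1 / c + 1 / d ↔ c * d / (c + d) ≤ 1 := by
  rw [div_add_div _ _ hc.ne' hd.ne', one_le_div (by positivity), div_le_one (by positivity)]
  constructor <;> intro h <;> linarith

/-- Theorem 4.1: for `c, d > 0` and `g(x) = x·F(c,d;c+d;x)`, the function
`G(u) = log g(e^u/(1+e^u))` is concave on `(-∞,∞)` if and only if `1/c + 1/d ≥ 1`. -/
theorem log_hypergeom_concave_iff (c d : ℝ) (hc : 0 < c) (hd : 0 < d) :
    ConcaveOn ℝ Set.univ (fun u : ℝ =>
        Real.log (Real.exp u / (1 + Real.exp u) *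
          hypergeom c d (c + d) (Real.exp u / (1 + Real.exp u)))) ↔
      1 ≤ 1 / c + 1 / d := by
  have hderiv := hasDerivAt_log_hypergeom_logistic hc hd
  rw [one_le_inv_add_inv_iff hc hd]
  constructor
  · intro hconc
    have hanti : ∀ x ∈ Set.Ioo (0 : ℝ) 1, ∀ y ∈ Set.Ioo (0 : ℝ) 1, x ≤ y →
        1 - y * (1 - balancedDerivNumerator c d y / hypergeom c d (c + d) y) ≤
          1 - x * (1 - balancedDerivNumerator c d x / hypergeom c d (c + d) x) := by
      intro x hx y hy hxy
      obtain ⟨u, rfl⟩ := exists_logistic_eq hx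
      obtain ⟨v, rfl⟩ := exists_logistic_eq hy
      rcases le_total u v with huv | hvu
      · have := hconc.antitoneOn_deriv (fun z _ => (hderiv z).differentiableAt)
          (Set.mem_univ u) (Set.mem_univ v) huv
        rwa [(hderiv u).deriv, (hderiv v).deriv] at this
      · rw [le_antisymm hxy (logistic_le_logistic hvu)]
    have hKF : ∀ y ∈ Set.Ioo (0 : ℝ) 1,
        balancedDerivNumerator c d y ≤ hypergeom c d (c + d) y := by
      intro y hy
      have hF := one_le_hypergeom_balanced hc hd hy.1.le hy.2
      have hlim : 1 - y * (1 - balancedDerivNumerator c d y / hypergeom c d (c + d) y) ≤ 1 := by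
        have ht : Filter.Tendsto (fun x : ℝ => 1 + c * d / (c + d) * x)
            (nhdsWithin 0 (Set.Ioi 0)) (nhds 1) := by
          refine tendsto_nhdsWithin_of_tendsto_nhds ?_
          refine Continuous.tendsto' (by fun_prop) _ _ (by simp)
        refine ge_of_tendsto ht ?_
        filter_upwards [Ioo_mem_nhdsGT hy.1] with x hx
        have hx1 : x < 1 := hx.2.trans hy.2
        refine (hanti x ⟨hx.1, hx1⟩ y hy hx.2.le).trans ?_
        have hFx := one_le_hypergeom_balanced hc hd hx.1.le hx1
        have hr : balancedDerivNumerator c d x / hypergeom c d (c + d) x ≤ c * d / (c + d) :=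
          (div_le_iff₀ (by linarith)).2 (balancedDerivNumerator_le hc hd hx.1.le hx1)
        nlinarith [mul_le_mul_of_nonneg_left hr hx.1.le, hx.1]
      have h0 : 0 ≤ 1 - balancedDerivNumerator c d y / hypergeom c d (c + d) y :=
        nonneg_of_mul_nonneg_right (by linarith) hy.1
      exact (div_le_one (by linarith)).1 (by linarith)
    have hcont : Filter.Tendsto (hypergeom c d (c + d)) (nhdsWithin 0 (Set.Ioi 0)) (nhds 1) := by
      have h := (hasDerivAt_hypergeom_balanced hc hd (x := 0) (by simp)).continuousAt
      have h0 : hypergeom c d (c + d) 0 = 1 := by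
        rw [hypergeom_balanced_eq, tsum_eq_single 0 fun n hn => by simp [hn]]
        simp [balancedCoeff_zero]
      rw [← h0]
      exact tendsto_nhdsWithin_of_tendsto_nhds h
    refine ge_of_tendsto hcont ?_
    filter_upwards [Ioo_mem_nhdsGT one_pos] with x hx
    exact (le_balancedDerivNumerator hc hd hx.1.le hx.2).trans (hKF x hx)
  · intro hp
    refine Antitone.concaveOn_univ_of_deriv (fun u => (hderiv u).differentiableAt) ?_
    intro u v huv
    rw [(hderiv u).deriv, (hderiv v).deriv]
    have hu := logistic_mem_Ioo u
    have hv := logistic_mem_Ioo v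
    have hxy := logistic_le_logistic huv
    have hr := antitoneOn_balanced_ratio hc hd hu hv hxy
    have hF := one_le_hypergeom_balanced hc hd hu.1.le hu.2
    have h1 : balancedDerivNumerator c d (Real.exp u / (1 + Real.exp u)) /
        hypergeom c d (c + d) (Real.exp u / (1 + Real.exp u)) ≤ 1 :=
      ((div_le_iff₀ (by linarith)).2 (balancedDerivNumerator_le hc hd hu.1.le hu.2)).trans hp
    refine sub_le_sub_left (mul_le_mul hxy (sub_le_sub_left hr 1) (by linarith) hv.1.le) 1
end

section
/- Let c, d > 0 with cd/(c+d) ≤ 1. Then (1/2)·F(c,d;c+d;1/2) < 1. -/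
/-- For `c, d > 0` with `cd ≤ c + d`, the Maclaurin coefficients of `₂F₁(c,d;c+d;x)` lie in
`[0, 1]`. -/
theorem hypergeom_coeff_mem_Icc {c d : ℝ} (hc : 0 < c) (hd : 0 < d) (h : c * d ≤ c + d) (n : ℕ) :
    (∏ k ∈ Finset.range n, (c + k)) * (∏ k ∈ Finset.range n, (d + k)) /
      ((∏ k ∈ Finset.range n, (c + d + k)) * (Nat.factorial n)) ∈ Set.Icc (0 : ℝ) 1 := by
  have hprod (x : ℝ) (hx : 0 < x) (n : ℕ) : 0 < ∏ k ∈ Finset.range n, (x + k) :=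
    Finset.prod_pos fun k _ => by positivity
  have hfac (n : ℕ) : (0 : ℝ) < Nat.factorial n := by positivity
  refine ⟨(div_pos (mul_pos (hprod c hc n) (hprod d hd n))
    (mul_pos (hprod _ (add_pos hc hd) n) (hfac n))).le, ?_⟩
  rw [div_le_one (mul_pos (hprod _ (add_pos hc hd) n) (hfac n))]
  induction n with
  | zero => simp
  | succ n ih =>
    simp only [Finset.prod_range_succ, Nat.factorial_succ, Nat.cast_mul, Nat.cast_add,
      Nat.cast_one]
    have hstep : (c + n) * (d + n) ≤ (c + d + n) * (n + 1) := by
      have hn : (0 : ℝ) ≤ n := n.cast_nonneg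
      linarith
    calc _ = ((∏ k ∈ Finset.range n, (c + k)) * (∏ k ∈ Finset.range n, (d + k))) *
          ((c + n) * (d + n)) := by ring
      _ ≤ ((∏ k ∈ Finset.range n, (c + d + k)) * (Nat.factorial n)) *
          ((c + d + n) * (n + 1)) :=
        mul_le_mul ih hstep (by positivity)
          (mul_pos (hprod _ (add_pos hc hd) n) (hfac n)).le
      _ = _ := by ring

/-- Corollary 4.5: for `c, d > 0` with `cd/(c+d) ≤ 1`, one has
`g(1/2) = (1/2)·F(c,d;c+d;1/2) < 1`. -/
theorem hypergeom_half_lt_one (c d : ℝ) (hc : 0 < c) (hd : 0 < d)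
    (ha0 : c * d / (c + d) ≤ 1) :
    (1 / 2 : ℝ) * hypergeom c d (c + d) (1 / 2) < 1 := by
  have h : c * d ≤ c + d := (div_le_one (add_pos hc hd)).1 ha0
  have hgeom : Summable fun n : ℕ => (1 / 2 : ℝ) ^ n := summable_geometric_two
  have hcoeff := hypergeom_coeff_mem_Icc hc hd h
  have hle (n : ℕ) := mul_le_of_le_one_left (pow_nonneg (by norm_num : (0 : ℝ) ≤ 1 / 2) n)
    (hcoeff n).2
  have hsum := hgeom.of_nonneg_of_le
    (fun n => mul_nonneg (hcoeff n).1 (pow_nonneg (by norm_num) n)) hle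
  have hlt : hypergeom c d (c + d) (1 / 2) < ∑' n : ℕ, (1 / 2 : ℝ) ^ n := by
    refine Summable.tsum_lt_tsum (i := 2) hle ?_ hsum hgeom
    refine mul_lt_of_lt_one_left (by positivity) ?_
    simp only [Finset.prod_range_succ, Finset.prod_range_zero, Nat.factorial]
    push_cast
    rw [div_lt_one (by positivity)]
    nlinarith [mul_pos hc hd, mul_le_mul_of_nonneg_right h
      (by positivity : (0 : ℝ) ≤ (c + 1) * (d + 1))]
  rw [tsum_geometric_two] at hlt
  linarith
end

section
/- Let c, d > 0 with c·d ≤ 1 and define g(x) = x·F(c,d;c+d;x) for x ∈ (0,1). Then for each fixed s > 0, the function p ↦ g(s^p/(1+s^p)) / p is monotone decreasing on (0,∞). -/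
/-- A ratio `(∑ bₙ uₙ) / (∑ uₙ)` with antitone `b` decreases when mass is shifted towards larger
indices, stated in cross-multiplied form. -/
theorem tsum_mul_tsum_le_of_antitone {b u v : ℕ → ℝ} (hb : Antitone b)
    (huv : ∀ n m, n ≤ m → u m * v n ≤ u n * v m)
    (hu : Summable u) (hv : Summable v)
    (hbu : Summable fun n => b n * u n) (hbv : Summable fun n => b n * v n) :
    (∑' n, b n * v n) * (∑' n, u n) ≤ (∑' n, b n * u n) * (∑' n, v n) := by
  refine le_of_tendsto_of_tendsto'
    (hbv.hasSum.tendsto_sum_nat.mul hu.hasSum.tendsto_sum_nat)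
    (hbu.hasSum.tendsto_sum_nat.mul hv.hasSum.tendsto_sum_nat) fun N => ?_
  have key : 0 ≤ ∑ n ∈ Finset.range N, ∑ m ∈ Finset.range N,
      (b n - b m) * (u n * v m - u m * v n) := by
    refine Finset.sum_nonneg fun n _ => Finset.sum_nonneg fun m _ => ?_
    rcases le_total n m with h | h
    · exact mul_nonneg (sub_nonneg.2 (hb h)) (sub_nonneg.2 (huv n m h))
    · exact mul_nonneg_of_nonpos_of_nonpos (sub_nonpos.2 (hb h)) (sub_nonpos.2 (huv m n h))
  have expand : ∑ n ∈ Finset.range N, ∑ m ∈ Finset.range N,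
      (b n - b m) * (u n * v m - u m * v n) =
      2 * ((∑ n ∈ Finset.range N, b n * u n) * (∑ n ∈ Finset.range N, v n) -
        (∑ n ∈ Finset.range N, b n * v n) * (∑ n ∈ Finset.range N, u n)) := by
    have h : ∀ n m, (b n - b m) * (u n * v m - u m * v n) =
        (b n * u n) * v m - (b n * v n) * u m - u n * (b m * v m) + v n * (b m * u m) := by
      intro n m; ring
    simp only [h, Finset.sum_add_distrib, Finset.sum_sub_distrib, ← Finset.sum_mul_sum]
    ring
  linarith

/-- The Maclaurin coefficients of `₂F₁(a,b;c;·)`. -/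
noncomputable def hypergeomCoeff (a b c : ℝ) (n : ℕ) : ℝ :=
  (∏ k ∈ Finset.range n, (a + k)) * (∏ k ∈ Finset.range n, (b + k)) /
    ((∏ k ∈ Finset.range n, (c + k)) * (Nat.factorial n))

theorem hypergeomCoeff_pos {a b c : ℝ} (ha : 0 < a) (hb : 0 < b) (hc : 0 < c) (n : ℕ) :
    0 < hypergeomCoeff a b c n := by
  have h : ∀ t : ℝ, 0 < t → 0 < ∏ k ∈ Finset.range n, (t + k) := fun t ht =>
    Finset.prod_pos fun k _ => by positivity
  have := h a ha
  have := h b hb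
  have := h c hc
  unfold hypergeomCoeff
  positivity

theorem hypergeomCoeff_succ (a b c : ℝ) (n : ℕ) :
    hypergeomCoeff a b c (n + 1) =
      hypergeomCoeff a b c n * ((a + n) * (b + n) / ((c + n) * (n + 1))) := by
  simp only [hypergeomCoeff, Finset.prod_range_succ, Nat.factorial_succ]
  rw [div_mul_div_comm]
  push_cast
  congr 1 <;> ring

/-- For `cd ≤ 1`, the coefficients of `x · ₂F₁(c,d;c+d;x)` relative to those of `-log (1 - x)`
are decreasing. -/
theorem antitone_succ_mul_hypergeomCoeff {c d : ℝ} (hc : 0 < c) (hd : 0 < d) (hcd : c * d ≤ 1) :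
    Antitone fun n : ℕ => ((n : ℝ) + 1) * hypergeomCoeff c d (c + d) n := by
  refine antitone_nat_of_succ_le fun n => ?_
  have hpos := hypergeomCoeff_pos hc hd (add_pos hc hd) n
  have hcd' : 2 * (c * d) ≤ c + d := by
    nlinarith [sq_nonneg (c - d), mul_pos hc hd, mul_nonneg (mul_pos hc hd).le (sub_nonneg.2 hcd)]
  have hn : (0 : ℝ) ≤ n := n.cast_nonneg
  have hfac : ((n : ℝ) + 1 + 1) * ((c + n) * (d + n) / ((c + d + n) * (n + 1))) ≤ n + 1 := by
    rw [← mul_div_assoc, div_le_iff₀ (by positivity)]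
    nlinarith [mul_nonneg hn (sub_nonneg.2 hcd)]
  rw [hypergeomCoeff_succ]
  push_cast
  calc _ = (((n : ℝ) + 1 + 1) * ((c + n) * (d + n) / ((c + d + n) * (n + 1)))) *
        hypergeomCoeff c d (c + d) n := by ring
    _ ≤ _ := mul_le_mul_of_nonneg_right hfac hpos.le

theorem mul_hypergeom_eq_tsum (a b c x : ℝ) :
    x * hypergeom a b c x =
      ∑' n : ℕ, (((n : ℝ) + 1) * hypergeomCoeff a b c n) * (x ^ (n + 1) / (n + 1)) := by
  rw [hypergeom, ← tsum_mul_left]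
  refine tsum_congr fun n => ?_
  have : (n : ℝ) + 1 ≠ 0 := by positivity
  rw [hypergeomCoeff]
  field_simp
  ring

theorem summable_mul_hypergeom {c d : ℝ} (hc : 0 < c) (hd : 0 < d) (hcd : c * d ≤ 1)
    {x : ℝ} (hx0 : 0 ≤ x) (hx1 : x < 1) :
    Summable fun n : ℕ =>
      (((n : ℝ) + 1) * hypergeomCoeff c d (c + d) n) * (x ^ (n + 1) / (n + 1)) := by
  have hL := (Real.hasSum_pow_div_log_of_abs_lt_one (x := x) (by rwa [abs_of_nonneg hx0])).summable
  refine Summable.of_nonneg_of_le (fun n => ?_) (fun n => ?_) hL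
  · have := hypergeomCoeff_pos hc hd (add_pos hc hd) n
    positivity
  · have h := antitone_succ_mul_hypergeomCoeff hc hd hcd n.zero_le
    simp only [hypergeomCoeff, Finset.range_zero, Finset.prod_empty, Nat.factorial_zero,
      Nat.cast_zero, Nat.cast_one, zero_add, mul_one, div_one] at h
    exact mul_le_of_le_one_left (by positivity) h

theorem mul_hypergeom_nonneg {c d : ℝ} (hc : 0 < c) (hd : 0 < d) {x : ℝ} (hx : 0 ≤ x) :
    0 ≤ x * hypergeom c d (c + d) x := by
  rw [mul_hypergeom_eq_tsum]
  refine tsum_nonneg fun n => ?_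
  have := hypergeomCoeff_pos hc hd (add_pos hc hd) n
  positivity

theorem mul_hypergeom_mono {c d : ℝ} (hc : 0 < c) (hd : 0 < d) (hcd : c * d ≤ 1)
    {x y : ℝ} (hx : 0 ≤ x) (hxy : x ≤ y) (hy : y < 1) :
    x * hypergeom c d (c + d) x ≤ y * hypergeom c d (c + d) y := by
  rw [mul_hypergeom_eq_tsum, mul_hypergeom_eq_tsum]
  refine Summable.tsum_le_tsum (fun n => ?_) (summable_mul_hypergeom hc hd hcd hx (hxy.trans_lt hy))
    (summable_mul_hypergeom hc hd hcd (hx.trans hxy) hy)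
  have := hypergeomCoeff_pos hc hd (add_pos hc hd) n
  gcongr

/-- For `cd ≤ 1`, the ratio `x · ₂F₁(c,d;c+d;x) / (-log (1 - x))` is decreasing on `[0,1)`,
stated in cross-multiplied form. -/
theorem mul_hypergeom_mul_log_le {c d : ℝ} (hc : 0 < c) (hd : 0 < d) (hcd : c * d ≤ 1)
    {x y : ℝ} (hx : 0 ≤ x) (hxy : x ≤ y) (hy : y < 1) :
    y * hypergeom c d (c + d) y * -Real.log (1 - x) ≤
      x * hypergeom c d (c + d) x * -Real.log (1 - y) := by
  have hx1 := hxy.trans_lt hy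
  have hy0 := hx.trans hxy
  have hLx := Real.hasSum_pow_div_log_of_abs_lt_one (x := x) (by rwa [abs_of_nonneg hx])
  have hLy := Real.hasSum_pow_div_log_of_abs_lt_one (x := y) (by rwa [abs_of_nonneg hy0])
  rw [mul_hypergeom_eq_tsum, mul_hypergeom_eq_tsum, ← hLx.tsum_eq, ← hLy.tsum_eq]
  refine tsum_mul_tsum_le_of_antitone (antitone_succ_mul_hypergeomCoeff hc hd hcd)
    (fun n m hnm => ?_) hLx.summable hLy.summable
    (summable_mul_hypergeom hc hd hcd hx hx1) (summable_mul_hypergeom hc hd hcd hy0 hy)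
  obtain ⟨k, rfl⟩ := Nat.exists_eq_add_of_le hnm
  rw [div_mul_div_comm, div_mul_div_comm, mul_comm (((n + k : ℕ) : ℝ) + 1)]
  refine div_le_div_of_nonneg_right ?_ (by positivity)
  calc x ^ (n + k + 1) * y ^ (n + 1) = (x * y) ^ (n + 1) * x ^ k := by ring
    _ ≤ (x * y) ^ (n + 1) * y ^ k := by gcongr
    _ = x ^ (n + 1) * y ^ (n + k + 1) := by ring

/-- The map `p ↦ log (1 + s ^ p) / p` is decreasing on `(0,∞)`. -/
theorem mul_log_one_add_rpow_le {s p q : ℝ} (hs : 0 < s) (hp : 0 < p) (hpq : p ≤ q) :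
    p * Real.log (1 + s ^ q) ≤ q * Real.log (1 + s ^ p) := by
  have hsp := Real.rpow_pos_of_pos hs p
  have hsq := Real.rpow_pos_of_pos hs q
  have h := Real.add_rpow_le_rpow_add (a := 1) (b := s ^ p) zero_le_one hsp.le
    ((one_le_div hp).2 hpq)
  rw [Real.one_rpow, ← Real.rpow_mul hs.le, mul_div_cancel₀ q hp.ne'] at h
  have h' := Real.log_le_log (by positivity) h
  rw [Real.log_rpow (by positivity), div_mul_eq_mul_div, le_div_iff₀ hp] at h'
  linarith

theorem div_one_add_le_div_one_add {t u : ℝ} (ht : 0 ≤ t) (htu : t ≤ u) :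
    t / (1 + t) ≤ u / (1 + u) := by
  rw [div_le_div_iff₀ (by linarith) (by linarith)]
  linarith

theorem neg_log_one_sub_div_one_add {t : ℝ} (ht : 0 ≤ t) :
    -Real.log (1 - t / (1 + t)) = Real.log (1 + t) := by
  have : 1 - t / (1 + t) = (1 + t)⁻¹ := by
    field_simp
    ring
  rw [this, Real.log_inv, neg_neg]

/-- Lemma 4.7: for fixed `s > 0` and `c, d > 0` with `cd ≤ 1`, the function
`p ↦ g(s^p/(1+s^p))/p`, where `g(x) = x·F(c,d;c+d;x)`, is monotone decreasing
on `(0,∞)`. -/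
theorem hypergeom_ratio_antitone (c d : ℝ) (hc : 0 < c) (hd : 0 < d) (hcd : c * d ≤ 1)
    (s : ℝ) (hs : 0 < s) :
    AntitoneOn (fun p : ℝ =>
        s ^ p / (1 + s ^ p) * hypergeom c d (c + d) (s ^ p / (1 + s ^ p)) / p)
      (Set.Ioi 0) := by
  intro p hp q hq hpq
  have hp : 0 < p := hp
  have hq : 0 < q := hq
  have hsp := Real.rpow_pos_of_pos hs p
  have hsq := Real.rpow_pos_of_pos hs q
  have lt_one : ∀ t : ℝ, 0 < t → t / (1 + t) < 1 := fun t ht => by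
    rw [div_lt_one (by positivity)]
    linarith
  have hg := mul_hypergeom_nonneg hc hd (x := s ^ p / (1 + s ^ p)) (by positivity)
  rcases le_total s 1 with h1 | h1
  · have hle := div_one_add_le_div_one_add hsq.le
      (Real.rpow_le_rpow_of_exponent_ge hs h1 hpq)
    exact div_le_div₀ hg (mul_hypergeom_mono hc hd hcd (by positivity) hle (lt_one _ hsp)) hp hpq
  · have hle := div_one_add_le_div_one_add hsp.le (Real.rpow_le_rpow_of_exponent_le h1 hpq)
    have h := mul_hypergeom_mul_log_le hc hd hcd (by positivity) hle (lt_one _ hsq)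
    rw [neg_log_one_sub_div_one_add hsp.le, neg_log_one_sub_div_one_add hsq.le] at h
    have hlog : 0 < Real.log (1 + s ^ p) := Real.log_pos (by linarith)
    refine (div_le_div_iff₀ hq hp).2 (le_of_mul_le_mul_right ?_ hlog)
    calc _ = s ^ q / (1 + s ^ q) * hypergeom c d (c + d) (s ^ q / (1 + s ^ q)) *
          Real.log (1 + s ^ p) * p := by ring
      _ ≤ s ^ p / (1 + s ^ p) * hypergeom c d (c + d) (s ^ p / (1 + s ^ p)) *
          Real.log (1 + s ^ q) * p := mul_le_mul_of_nonneg_right h hp.le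
      _ = s ^ p / (1 + s ^ p) * hypergeom c d (c + d) (s ^ p / (1 + s ^ p)) *
          (p * Real.log (1 + s ^ q)) := by ring
      _ ≤ s ^ p / (1 + s ^ p) * hypergeom c d (c + d) (s ^ p / (1 + s ^ p)) *
          (q * Real.log (1 + s ^ p)) :=
        mul_le_mul_of_nonneg_left (mul_log_one_add_rpow_le hs hp hpq) hg
      _ = _ := by ring
end

section
/- Let c, d > 0 with c·d ≤ 1 and define g(x) = x·F(c,d;c+d;x) for x ∈ (0,1). Then for all s, p, q > 0, g(s^p/(1+s^p)) + g(s^q/(1+s^q)) ≥ g(s^{p+q}/(1+s^{p+q})). -/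
theorem summable_antitone_mul_pow {w : ℕ → ℝ} (hw : Antitone w) (h0 : ∀ n, 0 ≤ w n) {x : ℝ}
    (hx : |x| < 1) : Summable fun n => w n * x ^ n := by
  refine Summable.of_norm_bounded
    ((summable_geometric_of_lt_one (abs_nonneg x) hx).mul_left (w 0)) fun n => ?_
  rw [norm_mul, norm_pow, Real.norm_eq_abs, Real.norm_eq_abs, abs_of_nonneg (h0 n)]
  gcongr
  exact hw (Nat.zero_le n)

/-- Termwise integration of the power series with antitone nonnegative coefficients `w`. -/
theorem hasDerivAt_tsum_antitone {w : ℕ → ℝ} (hw : Antitone w) (h0 : ∀ n, 0 ≤ w n) {x : ℝ}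
    (hx : |x| < 1) :
    HasDerivAt (fun y => ∑' n : ℕ, w n / (n + 1) * y ^ (n + 1)) (∑' n : ℕ, w n * x ^ n) x := by
  obtain ⟨r, hxr, hr⟩ := exists_between hx
  have hr0 : 0 ≤ r := (abs_nonneg x).trans hxr.le
  refine hasDerivAt_tsum_of_isPreconnected (t := Metric.ball (0 : ℝ) r) (y₀ := 0)
    (g := fun n y => w n / (n + 1) * y ^ (n + 1)) (g' := fun n y => w n * y ^ n)
    (u := fun n => w 0 * r ^ n)
    ((summable_geometric_of_lt_one hr0 hr).mul_left (w 0)) Metric.isOpen_ball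
    (convex_ball _ _).isPreconnected (fun n y _ => ?_) (fun n y hy => ?_) ?_ ?_ ?_
  · have h := (hasDerivAt_pow (n + 1) y).const_mul (w n / (n + 1))
    refine h.congr_deriv ?_
    have : (n : ℝ) + 1 ≠ 0 := by positivity
    push_cast
    field_simp
  · rw [mem_ball_zero_iff] at hy
    rw [norm_mul, norm_pow, Real.norm_of_nonneg (h0 n)]
    gcongr
    · exact h0 0
    · exact hw (Nat.zero_le n)
  · simpa using (abs_nonneg x).trans_lt hxr
  · simp [summable_zero]
  · simpa using hxr

theorem one_sub_mul_tsum_antitone {w : ℕ → ℝ} (hw : Antitone w) (h0 : ∀ n, 0 ≤ w n) {x y : ℝ}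
    (hx : 0 ≤ x) (hxy : x ≤ y) (hy : y < 1) :
    (1 - y) * ∑' n : ℕ, w n * y ^ n ≤ (1 - x) * ∑' n : ℕ, w n * x ^ n := by
  have key : ∀ z : ℝ, 0 ≤ z → z < 1 →
      Summable (fun n => (w n - w (n + 1)) * z ^ (n + 1)) ∧
      (1 - z) * ∑' n : ℕ, w n * z ^ n = w 0 - ∑' n : ℕ, (w n - w (n + 1)) * z ^ (n + 1) := by
    intro z hz hz1
    have hs := summable_antitone_mul_pow hw h0 (abs_lt.2 ⟨by linarith, hz1⟩)
    have hs1 := (summable_nat_add_iff 1).2 hs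
    have hsz := hs.mul_left z
    have he : (fun n => (w n - w (n + 1)) * z ^ (n + 1)) =
        fun n => z * (w n * z ^ n) - w (n + 1) * z ^ (n + 1) := by
      funext n; ring
    rw [he]
    refine ⟨hsz.sub hs1, ?_⟩
    rw [hsz.tsum_sub hs1, tsum_mul_left]
    have := hs.tsum_eq_zero_add
    simp only [pow_zero, mul_one] at this
    linarith
  obtain ⟨hsx, hex⟩ := key x hx (hxy.trans_lt hy)
  obtain ⟨hsy, hey⟩ := key y (hx.trans hxy) hy
  rw [hex, hey]
  refine sub_le_sub_left (hsx.tsum_le_tsum (fun n => ?_) hsy) _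
  have := sub_nonneg.2 (hw n.le_succ)
  gcongr

/-- A function with derivative `f'` such that `(1 - x) f' x` is antitone is subadditive for the
operation `x + y - x * y` on `[0, 1)`. -/
theorem subadditive_of_one_sub_mul_deriv_antitone {f f' : ℝ → ℝ} (hf0 : f 0 = 0)
    (hf : ∀ x, 0 ≤ x → x < 1 → HasDerivAt f (f' x) x)
    (hf' : ∀ x y, 0 ≤ x → x ≤ y → y < 1 → (1 - y) * f' y ≤ (1 - x) * f' x)
    {x y : ℝ} (hx : 0 ≤ x) (hx1 : x < 1) (hy : 0 ≤ y) (hy1 : y < 1) :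
    f (x + y - x * y) ≤ f x + f y := by
  have hz : ∀ t, 0 ≤ t → t < 1 → t ≤ t + y - t * y ∧ t + y - t * y < 1 := fun t _ _ =>
    ⟨by nlinarith, by nlinarith⟩
  have hD : ∀ t, 0 ≤ t → t < 1 → HasDerivAt (fun t => f t - f (t + y - t * y))
      (f' t - f' (t + y - t * y) * (1 - y)) t := by
    intro t ht ht1
    obtain ⟨h1, h2⟩ := hz t ht ht1
    have hi : HasDerivAt (fun t : ℝ => t + y - t * y) (1 - y) t := by
      exact (((hasDerivAt_id t).add_const y).sub ((hasDerivAt_id t).mul_const y)).congr_deriv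
        (by simp)
    exact (hf t ht ht1).sub ((hf _ (ht.trans h1) h2).comp t hi)
  have hmono : MonotoneOn (fun t => f t - f (t + y - t * y)) (Set.Ico 0 1) := by
    refine monotoneOn_of_deriv_nonneg (convex_Ico 0 1)
      (fun t ht => (hD t ht.1 ht.2).continuousAt.continuousWithinAt)
      (fun t ht => ?_) fun t ht => ?_
    all_goals
      rw [interior_Ico] at ht
    · exact (hD t ht.1.le ht.2).differentiableAt.differentiableWithinAt
    · rw [(hD t ht.1.le ht.2).deriv]
      obtain ⟨h1, h2⟩ := hz t ht.1.le ht.2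
      have h := hf' t _ ht.1.le h1 h2
      have ht1 : 0 < 1 - t := sub_pos.2 ht.2
      refine nonneg_of_mul_nonneg_left (b := 1 - t) ?_ ht1
      nlinarith
  have h := hmono (Set.mem_Ico.2 ⟨le_rfl, one_pos⟩) (Set.mem_Ico.2 ⟨hx, hx1⟩) hx
  simp only [hf0, zero_add, zero_mul, sub_zero] at h
  linarith

theorem mul_hypergeom_coeff_antitone {c d : ℝ} (hc : 0 < c) (hd : 0 < d) (hcd : c * d ≤ 1) :
    Antitone fun n : ℕ => ((n : ℝ) + 1) *
      ((∏ k ∈ Finset.range n, (c + k)) * (∏ k ∈ Finset.range n, (d + k)) /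
        ((∏ k ∈ Finset.range n, (c + d + k)) * (Nat.factorial n))) := by
  refine antitone_nat_of_succ_le fun n => ?_
  have hC : 0 < ∏ k ∈ Finset.range n, (c + k) := Finset.prod_pos fun k _ => by positivity
  have hE : 0 < ∏ k ∈ Finset.range n, (d + k) := Finset.prod_pos fun k _ => by positivity
  have hS : 0 < ∏ k ∈ Finset.range n, (c + d + k) := Finset.prod_pos fun k _ => by positivity
  simp only [Finset.prod_range_succ, Nat.factorial_succ]
  push_cast
  generalize (∏ k ∈ Finset.range n, (c + (k : ℝ))) = C at *
  generalize (∏ k ∈ Finset.range n, (d + (k : ℝ))) = E at *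
  generalize (∏ k ∈ Finset.range n, (c + d + (k : ℝ))) = S at *
  have hF : (0 : ℝ) < Nat.factorial n := by positivity
  generalize (Nat.factorial n : ℝ) = F at *
  have hn : (0 : ℝ) ≤ n := n.cast_nonneg
  generalize (n : ℝ) = m at *
  have hsum : 2 * (c * d) ≤ c + d := by
    nlinarith [sq_nonneg (c - d), mul_pos hc hd]
  have hpoly : (m + 2) * ((c + m) * (d + m)) ≤ (m + 1) * ((m + 1) * (c + d + m)) := by
    nlinarith [mul_nonneg hn (sub_nonneg.2 hcd)]
  have h1 : (m + 1 + 1) * (C * (c + m) * (E * (d + m)) / (S * (c + d + m) * ((m + 1) * F))) =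
      C * E / (S * F) * ((m + 2) * ((c + m) * (d + m)) / ((m + 1) * (c + d + m))) := by
    field_simp
    ring
  rw [h1, mul_comm (m + 1) (C * E / (S * F))]
  have hq : (m + 2) * ((c + m) * (d + m)) / ((m + 1) * (c + d + m)) ≤ m + 1 := by
    rw [div_le_iff₀ (by positivity)]
    exact hpoly
  exact mul_le_mul_of_nonneg_left hq (by positivity)

/-- Corollary 4.9: for `c, d > 0` with `cd ≤ 1` and `g(x) = x·F(c,d;c+d;x)`,
`g(s^p/(1+s^p)) + g(s^q/(1+s^q)) ≥ g(s^{p+q}/(1+s^{p+q}))` for all `s, p, q > 0`. -/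
theorem hypergeom_superadditive (c d : ℝ) (hc : 0 < c) (hd : 0 < d) (hcd : c * d ≤ 1)
    (s p q : ℝ) (hs : 0 < s) (hp : 0 < p) (hq : 0 < q) :
    s ^ p / (1 + s ^ p) * hypergeom c d (c + d) (s ^ p / (1 + s ^ p)) +
        s ^ q / (1 + s ^ q) * hypergeom c d (c + d) (s ^ q / (1 + s ^ q)) ≥
      s ^ (p + q) / (1 + s ^ (p + q)) *
        hypergeom c d (c + d) (s ^ (p + q) / (1 + s ^ (p + q))) := by
  have hw := mul_hypergeom_coeff_antitone hc hd hcd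
  set w : ℕ → ℝ := fun n : ℕ => ((n : ℝ) + 1) *
      ((∏ k ∈ Finset.range n, (c + k)) * (∏ k ∈ Finset.range n, (d + k)) /
        ((∏ k ∈ Finset.range n, (c + d + k)) * (Nat.factorial n))) with hwdef
  have h0 : ∀ n, 0 ≤ w n := fun n => by
    have hC : 0 < ∏ k ∈ Finset.range n, (c + k) := Finset.prod_pos fun k _ => by positivity
    have hE : 0 < ∏ k ∈ Finset.range n, (d + k) := Finset.prod_pos fun k _ => by positivity
    have hS : 0 < ∏ k ∈ Finset.range n, (c + d + k) := Finset.prod_pos fun k _ => by positivity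
    simp only [hwdef]
    positivity
  set g : ℝ → ℝ := fun y => ∑' n : ℕ, w n / (n + 1) * y ^ (n + 1) with hg
  have hgx : ∀ x, x * hypergeom c d (c + d) x = g x := fun x => by
    rw [hypergeom, ← tsum_mul_left]
    refine tsum_congr fun n => ?_
    have : (n : ℝ) + 1 ≠ 0 := by positivity
    rw [hwdef]
    simp only [mul_div_cancel_left₀ _ this]
    ring
  have hgd : ∀ x, 0 ≤ x → x < 1 → HasDerivAt g (∑' n : ℕ, w n * x ^ n) x := fun x hx hx1 =>
    hasDerivAt_tsum_antitone hw h0 (abs_lt.2 ⟨by linarith, hx1⟩)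
  have hgm : MonotoneOn g (Set.Ico 0 1) := by
    refine monotoneOn_of_deriv_nonneg (convex_Ico 0 1)
      (fun t ht => (hgd t ht.1 ht.2).continuousAt.continuousWithinAt)
      (fun t ht => ?_) fun t ht => ?_
    all_goals
      rw [interior_Ico] at ht
    · exact (hgd t ht.1.le ht.2).differentiableAt.differentiableWithinAt
    · rw [(hgd t ht.1.le ht.2).deriv]
      exact tsum_nonneg fun n => mul_nonneg (h0 n) (pow_nonneg ht.1.le n)
  rw [hgx, hgx, hgx, Real.rpow_add hs]
  have hu : 0 < s ^ p := Real.rpow_pos_of_pos hs p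
  have hv : 0 < s ^ q := Real.rpow_pos_of_pos hs q
  generalize s ^ p = u at *
  generalize s ^ q = v at *
  have hlt : ∀ t : ℝ, 0 < t → 0 ≤ t / (1 + t) ∧ t / (1 + t) < 1 := fun t ht =>
    ⟨by positivity, by rw [div_lt_one (by positivity)]; linarith⟩
  obtain ⟨hx, hx1⟩ := hlt u hu
  obtain ⟨hy, hy1⟩ := hlt v hv
  have hsub := subadditive_of_one_sub_mul_deriv_antitone (f := g) (by simp [hg]) hgd
    (fun x y h1 h2 h3 => one_sub_mul_tsum_antitone hw h0 h1 h2 h3) hx hx1 hy hy1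
  have hz : u / (1 + u) + v / (1 + v) - u / (1 + u) * (v / (1 + v)) =
      (u + v + u * v) / (1 + (u + v + u * v)) := by
    field_simp
    ring
  rw [hz] at hsub
  refine (hgm (hlt _ (mul_pos hu hv)) (hlt _ (by positivity)) ?_).trans hsub
  rw [div_le_div_iff₀ (by positivity) (by positivity)]
  nlinarith
end
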